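/- Fix 1 ≤ k ≤ n−2 and Z ∈ Mat^{>0}_{n,k+2} with rows Z_1,…,Z_n; set Ẑ_i := (−1)^{k+1} Z_i. For w ∈ D_{k+1,n}, define the open w-chamber Å_w to be the set of Y ∈ A_{n,k,2}(Z) such that, for every a ∈ [n], the sign flips of the length-n sequence (⟨Y Z_a Ẑ_1⟩, ⟨Y Z_a Ẑ_2⟩, …, ⟨Y Z_a Ẑ_{a−1}⟩, ⟨Y Z_a Z_a⟩, ⟨Y Z_a Z_{a+1}⟩, …, ⟨Y Z_a Z_n⟩) occur precisely in the positions I_a(w) ∖ {a}, where a sign flip occurs in position j if the j-th and (j+1)-st entries (cyclically, so j = n is followed by j+1 = 1) are both nonzero and have opposite signs. Then A_{n,k,2}(Z) = ∪_{w ∈ D_{k+1,n}} closure(Å_w), the closures taken in Gr_{k,k+2}. -/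

import Mathlib

noncomputable section

/-- The Pluecker coordinate of the full-rank `k x n` matrix `C` on the column set `S`
(the minor on the columns in `S`, taken in increasing order). -/
def pluck {k n : ℕ} (C : Matrix (Fin k) (Fin n) ℝ) (S : Finset (Fin n))
    (h : S.card = k) : ℝ :=
  (C.submatrix id (fun t => ((S.orderIsoOfFin h) t).val)).det

/-- All maximal (`p x p`) minors of the `n x p` matrix `Z` are positive. -/
def posMaxMinors {n p : ℕ} (Z : Matrix (Fin n) (Fin p) ℝ) : Prop :=
  ∀ (S : Finset (Fin n)) (h : S.card = p),
    0 < (Z.submatrix (fun t => ((S.orderIsoOfFin h) t).val) id).det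

/-- Twistor-type determinant: the determinant of the square matrix whose first
`k` rows are the rows of `Y` and whose last `m` rows are `u 0, ..., u (m-1)`. -/
def twist {k m : ℕ} (Y : Matrix (Fin k) (Fin (k + m)) ℝ)
    (u : Fin m → Fin (k + m) → ℝ) : ℝ :=
  (Matrix.of (Fin.append (fun i => Y i) u)).det

/-- Full-rank `k x n` real matrices (those with linearly independent rows). -/
def FullRk (k n : ℕ) : Type :=
  {C : Matrix (Fin k) (Fin n) ℝ // LinearIndependent ℝ (fun i => C i)}

instance (k n : ℕ) : TopologicalSpace (FullRk k n) :=
  inferInstanceAs (TopologicalSpace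
    {C : Matrix (Fin k) (Fin n) ℝ // LinearIndependent ℝ (fun i => C i)})

/-- Two full-rank matrices are equivalent iff they have the same row span. -/
def grSetoid (k n : ℕ) : Setoid (FullRk k n) :=
  ⟨fun C D => Submodule.span ℝ (Set.range (fun i => C.1 i)) =
      Submodule.span ℝ (Set.range (fun i => D.1 i)),
    ⟨fun _ => rfl, fun h => h.symm, fun h1 h2 => h1.trans h2⟩⟩

/-- The real Grassmannian `Gr_{k,n}`: full-rank `k x n` matrices modulo row
operations, equipped with the quotient topology. -/
def Gr (k n : ℕ) : Type := Quotient (grSetoid k n)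

instance (k n : ℕ) : TopologicalSpace (Gr k n) :=
  inferInstanceAs (TopologicalSpace (Quotient (grSetoid k n)))

/-- The point of `Gr k n` represented by the full-rank matrix `C`. -/
def grMk {k n : ℕ} (C : Matrix (Fin k) (Fin n) ℝ)
    (h : LinearIndependent ℝ (fun i => C i)) : Gr k n :=
  Quotient.mk (grSetoid k n) ⟨C, h⟩

/-- The set of cyclic left descents of `w` (with values recorded 0-based:
the value `i ∈ [n]` corresponds to `i - 1 : Fin n`). -/
def cdes {n : ℕ} (w : Equiv.Perm (Fin n)) : Finset (Fin n) :=
  Finset.univ.filter (fun i =>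
    (i.val = 0 ∧ w.symm i < w.symm
        ⟨n - 1, Nat.sub_lt (Nat.lt_of_le_of_lt (Nat.zero_le _) i.isLt) Nat.one_pos⟩) ∨
    (i.val ≠ 0 ∧ w.symm i < w.symm
        ⟨i.val - 1, Nat.lt_of_le_of_lt (Nat.sub_le _ _) i.isLt⟩))

/-- The cyclic rotation of (the one-line notation of) `w` whose last entry is
the value `a`. -/
def rotTo {n : ℕ} (w : Equiv.Perm (Fin n)) (a : Fin n) : Equiv.Perm (Fin n) :=
  w * (finRotate n) ^ ((w.symm a).val + 1)

/-- `Iset w q` is the set `I_{q+1}(w)` (0-based indexing): `I_1(w) = cdes w`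
and `I_r(w) = cdes (w^{(r-1)})` for `2 ≤ r ≤ n`. -/
def Iset {n : ℕ} (w : Equiv.Perm (Fin n)) (q : Fin n) : Finset (Fin n) :=
  if _h : q.val = 0 then cdes w
  else cdes (rotTo w ⟨q.val - 1, Nat.lt_of_le_of_lt (Nat.sub_le _ _) q.isLt⟩)

/-- The `a`-th sign-flip sequence of `Y` with respect to `Z`:
entry `j` is `⟨Y Z_a Ẑ_j⟩` for `j < a` (where `Ẑ_j = (-1)^(k+1) Z_j`) and
`⟨Y Z_a Z_j⟩` for `j ≥ a`. -/
def vseq {k n : ℕ} (Z : Matrix (Fin n) (Fin (k + 2)) ℝ)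
    (Y : Matrix (Fin k) (Fin (k + 2)) ℝ) (a j : Fin n) : ℝ :=
  if j < a then twist Y ![Z a, ((-1 : ℝ) ^ (k + 1)) • Z j]
  else twist Y ![Z a, Z j]

lemma append_update_left {k m : ℕ} {α : Type*} (Y : Fin k → α) (u : Fin m → α) (i : Fin k)
    (x : α) : Fin.append (Function.update Y i x) u =
      Function.update (Fin.append Y u) (Fin.castAdd m i) x := by
  ext t
  refine Fin.addCases (fun s => ?_) (fun s => ?_) t
  · by_cases h : s = i
    · subst h; simp
    · have : Fin.castAdd m s ≠ Fin.castAdd m i := fun h' => h (Fin.castAdd_injective _ _ h')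
      simp [Function.update_of_ne h, Function.update_of_ne this]
  · have : Fin.natAdd k s ≠ Fin.castAdd m i := by
      intro h'; have := congrArg Fin.val h'; simp at this; omega
    simp [Function.update_of_ne this]

lemma append_update_right {k m : ℕ} {α : Type*} (Y : Fin k → α) (u : Fin m → α) (i : Fin m)
    (x : α) : Fin.append Y (Function.update u i x) =
      Function.update (Fin.append Y u) (Fin.natAdd k i) x := by
  ext t
  refine Fin.addCases (fun s => ?_) (fun s => ?_) t
  · have : Fin.castAdd m s ≠ Fin.natAdd k i := by
      intro h'; have := congrArg Fin.val h'; simp at this; omega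
    simp [Function.update_of_ne this]
  · by_cases h : s = i
    · subst h; simp
    · have : Fin.natAdd k s ≠ Fin.natAdd k i := fun h' => h (Fin.natAdd_injective _ _ h')
      simp [Function.update_of_ne h, Function.update_of_ne this]

/-- `twist` as an alternating map in the rows of its first argument. -/
def twistAlt {k m : ℕ} (u : Fin m → Fin (k + m) → ℝ) :
    (Fin (k + m) → ℝ) [⋀^Fin k]→ₗ[ℝ] ℝ where
  toFun Y := twist (Matrix.of Y) u
  map_update_add' := by
    intro inst Y i x y
    rw [Subsingleton.elim inst (instDecidableEqFin k)]
    have h := (Matrix.detRowAlternating (R := ℝ) (n := Fin (k + m))).map_update_add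
      (Fin.append Y u) (Fin.castAdd m i) x y
    rw [← append_update_left, ← append_update_left, ← append_update_left] at h
    exact h
  map_update_smul' := by
    intro inst Y i c x
    rw [Subsingleton.elim inst (instDecidableEqFin k)]
    have h := (Matrix.detRowAlternating (R := ℝ) (n := Fin (k + m))).map_update_smul
      (Fin.append Y u) (Fin.castAdd m i) c x
    rw [← append_update_left, ← append_update_left] at h
    exact h
  map_eq_zero_of_eq' := by
    intro Y i j hij hne
    refine Matrix.det_zero_of_row_eq (i := Fin.castAdd m i) (j := Fin.castAdd m j)
      (fun h => hne (Fin.castAdd_injective _ _ h)) ?_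
    show Fin.append Y u _ = Fin.append Y u _
    simpa using hij

lemma update_pair_zero {α : Type*} (a b x : α) : Function.update ![a, b] 0 x = ![x, b] := by
  ext i; fin_cases i <;> rfl

lemma update_pair_one {α : Type*} (a b x : α) : Function.update ![a, b] 1 x = ![a, x] := by
  ext i; fin_cases i <;> rfl

/-- For fixed `Y`, the twistor coordinate as a bilinear form. -/
def twistBil {k : ℕ} (Y : Matrix (Fin k) (Fin (k + 2)) ℝ) :
    (Fin (k + 2) → ℝ) →ₗ[ℝ] (Fin (k + 2) → ℝ) →ₗ[ℝ] ℝ :=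
  have add (i : Fin 2) (u : Fin 2 → Fin (k + 2) → ℝ) (x y : Fin (k + 2) → ℝ) :
      twist Y (Function.update u i (x + y)) =
        twist Y (Function.update u i x) + twist Y (Function.update u i y) := by
    have h := (Matrix.detRowAlternating (R := ℝ) (n := Fin (k + 2))).map_update_add
      (Fin.append (fun i => Y i) u) (Fin.natAdd k i) x y
    rw [← append_update_right, ← append_update_right, ← append_update_right] at h
    exact h
  have smul (i : Fin 2) (u : Fin 2 → Fin (k + 2) → ℝ) (c : ℝ) (x : Fin (k + 2) → ℝ) :
      twist Y (Function.update u i (c • x)) = c * twist Y (Function.update u i x) := by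
    have h := (Matrix.detRowAlternating (R := ℝ) (n := Fin (k + 2))).map_update_smul
      (Fin.append (fun i => Y i) u) (Fin.natAdd k i) c x
    rw [← append_update_right, ← append_update_right] at h
    exact h
  LinearMap.mk₂ ℝ (fun x y => twist Y ![x, y])
    (fun x x' y => by simpa only [update_pair_zero] using add 0 ![0, y] x x')
    (fun c x y => by simpa only [update_pair_zero, smul_eq_mul] using smul 0 ![0, y] c x)
    (fun x y y' => by simpa only [update_pair_one] using add 1 ![x, 0] y y')
    (fun c x y => by simpa only [update_pair_one, smul_eq_mul] using smul 1 ![x, 0] c y)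

lemma twistBil_apply {k : ℕ} (Y : Matrix (Fin k) (Fin (k + 2)) ℝ) (x y : Fin (k + 2) → ℝ) :
    twistBil Y x y = twist Y ![x, y] := rfl

lemma twistBil_self {k : ℕ} (Y : Matrix (Fin k) (Fin (k + 2)) ℝ) (x : Fin (k + 2) → ℝ) :
    twistBil Y x x = 0 := by
  refine Matrix.det_zero_of_row_eq (i := Fin.natAdd k 0) (j := Fin.natAdd k 1)
    (fun h => by simpa using Fin.natAdd_injective _ _ h) ?_
  show Fin.append (fun i => Y i) _ _ = Fin.append (fun i => Y i) _ _
  simp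

lemma twistBil_row_right {k : ℕ} (Y : Matrix (Fin k) (Fin (k + 2)) ℝ) (x : Fin (k + 2) → ℝ)
    (i : Fin k) : twistBil Y x (Y i) = 0 := by
  refine Matrix.det_zero_of_row_eq (i := Fin.natAdd k 1) (j := Fin.castAdd 2 i)
    (fun h => by have := congrArg Fin.val h; simp at this; omega) ?_
  show Fin.append (fun i => Y i) _ _ = Fin.append (fun i => Y i) _ _
  simp

lemma twistBil_antisymm {k : ℕ} (Y : Matrix (Fin k) (Fin (k + 2)) ℝ) (x y : Fin (k + 2) → ℝ) :
    twistBil Y x y = - twistBil Y y x := by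
  have h := twistBil_self Y (x + y)
  simp only [map_add, LinearMap.add_apply, twistBil_self] at h
  linarith

/-- All maximal minors of a `p × n` matrix (columns in increasing order) are positive. -/
def MinorsPos {p n : ℕ} (C : Matrix (Fin p) (Fin n) ℝ) : Prop :=
  ∀ f : Fin p → Fin n, StrictMono f → 0 < (C.submatrix id f).det

/-- All maximal minors of a `p × n` matrix (columns in increasing order) are nonnegative. -/
def MinorsNonneg {p n : ℕ} (C : Matrix (Fin p) (Fin n) ℝ) : Prop :=
  ∀ f : Fin p → Fin n, StrictMono f → 0 ≤ (C.submatrix id f).det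

lemma MinorsPos.nonneg {p n : ℕ} {C : Matrix (Fin p) (Fin n) ℝ} (h : MinorsPos C) :
    MinorsNonneg C := fun f hf => (h f hf).le

lemma exists_orderIso_eq {p n : ℕ} {f : Fin p → Fin n} (hf : StrictMono f) :
    ∃ (S : Finset (Fin n)) (h : S.card = p), (fun t => ((S.orderIsoOfFin h) t).val) = f := by
  refine ⟨Finset.univ.image f, ?_, ?_⟩
  · rw [Finset.card_image_of_injective _ hf.injective]; simp
  · symm
    exact Finset.orderEmbOfFin_unique (by rw [Finset.card_image_of_injective _ hf.injective]; simp)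
      (fun x => by simp) hf

lemma strictMono_orderIso {p n : ℕ} (S : Finset (Fin n)) (h : S.card = p) :
    StrictMono (fun t => ((S.orderIsoOfFin h) t).val) :=
  (S.orderEmbOfFin h).strictMono

lemma minorsNonneg_iff {k n : ℕ} (C : Matrix (Fin k) (Fin n) ℝ) :
    MinorsNonneg C ↔ ∀ (S : Finset (Fin n)) (h : S.card = k), 0 ≤ pluck C S h := by
  constructor
  · exact fun H S h => H _ (strictMono_orderIso S h)
  · intro H f hf
    obtain ⟨S, h, rfl⟩ := exists_orderIso_eq hf
    exact H S h

lemma posMaxMinors.transpose {n p : ℕ} {Z : Matrix (Fin n) (Fin p) ℝ} (hZ : posMaxMinors Z) :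
    MinorsPos Z.transpose := by
  intro f hf
  obtain ⟨S, h, rfl⟩ := exists_orderIso_eq hf
  rw [← Matrix.det_transpose]
  exact hZ S h

lemma exists_perm_strictMono {p n : ℕ} {f : Fin p → Fin n} (hf : Function.Injective f) :
    ∃ σ : Equiv.Perm (Fin p), StrictMono (f ∘ σ) :=
  ⟨Tuple.sort f, (Tuple.monotone_sort f).strictMono_of_injective
    (hf.comp (Tuple.sort f).injective)⟩

/-- The Vandermonde product of a tuple. -/
def vdm {p : ℕ} (x : Fin p → ℝ) : ℝ := (Matrix.vandermonde x).det

lemma vdm_eq {p : ℕ} (x : Fin p → ℝ) :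
    vdm x = ∏ i, ∏ j, if i < j then x j - x i else 1 := by
  rw [vdm, Matrix.det_vandermonde]
  refine Finset.prod_congr rfl fun i _ => ?_
  rw [← Finset.prod_filter]
  congr 1
  ext j; simp

lemma vdm_append {p : ℕ} (x : Fin p → ℝ) (a b : ℝ) :
    vdm (Fin.append x ![a, b]) = vdm x * (∏ t, (a - x t) * (b - x t)) * (b - a) := by
  simp only [vdm_eq, Fin.prod_univ_add, Fin.append_left, Fin.append_right, Fin.prod_univ_two]
  have h1 : ∀ (i : Fin p) (j : Fin 2), Fin.castAdd 2 i < Fin.natAdd p j := fun i j => by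
    rw [Fin.lt_def]; simp; omega
  have h2 : ∀ (i : Fin p) (j : Fin 2), ¬ Fin.natAdd p j < Fin.castAdd 2 i := fun i j =>
    not_lt.2 (h1 i j).le
  have h3 : ∀ (i j : Fin p), Fin.castAdd 2 i < Fin.castAdd 2 j ↔ i < j := fun i j => Iff.rfl
  have h4 : ∀ (i j : Fin 2), Fin.natAdd p i < Fin.natAdd p j ↔ i < j := fun i j => by
    simp
  simp only [h1, h2, h3, h4, if_true, if_false]
  simp [Finset.prod_mul_distrib]

lemma vdm_pos {p n : ℕ} {f : Fin p → Fin n} (hf : StrictMono f) :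
    0 < vdm (fun t => ((f t : ℕ) : ℝ)) := by
  rw [vdm_eq]
  refine Finset.prod_pos fun i _ => Finset.prod_pos fun j _ => ?_
  split_ifs with h
  · have : (f i : ℕ) < f j := hf h
    have : ((f i : ℕ) : ℝ) < (f j : ℕ) := by exact_mod_cast this
    linarith
  · exact one_pos

lemma vdm_comp_perm {p : ℕ} (x : Fin p → ℝ) (σ : Equiv.Perm (Fin p)) :
    vdm (x ∘ σ) = (Equiv.Perm.sign σ : ℤ) * vdm x := by
  rw [vdm, vdm, ← Matrix.det_permute]
  rfl

lemma permSign_mul_mul {p : ℕ} (σ : Equiv.Perm (Fin p)) (x y : ℝ) :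
    ((Equiv.Perm.sign σ : ℤ) * x : ℝ) * ((Equiv.Perm.sign σ : ℤ) * y) = x * y := by
  have : ((Equiv.Perm.sign σ : ℤ) : ℝ) * ((Equiv.Perm.sign σ : ℤ) : ℝ) = 1 := by
    rcases Int.units_eq_one_or (Equiv.Perm.sign σ) with h | h <;> simp [h]
  linear_combination x * y * this

lemma det_mul_vdm_perm {p n : ℕ} (C : Matrix (Fin p) (Fin n) ℝ) (f : Fin p → Fin n)
    (σ : Equiv.Perm (Fin p)) :
    (C.submatrix id (f ∘ σ)).det * vdm (fun t => (((f ∘ σ) t : ℕ) : ℝ)) =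
      (C.submatrix id f).det * vdm (fun t => ((f t : ℕ) : ℝ)) := by
  have h1 : (C.submatrix id (f ∘ σ)) = (C.submatrix id f).submatrix id σ := rfl
  have h2 : (fun t => (((f ∘ σ) t : ℕ) : ℝ)) = (fun t => ((f t : ℕ) : ℝ)) ∘ σ := rfl
  rw [h1, h2, Matrix.det_permute', vdm_comp_perm, permSign_mul_mul]

lemma MinorsPos.det_mul_vdm {p n : ℕ} {C : Matrix (Fin p) (Fin n) ℝ} (hC : MinorsPos C)
    {f : Fin p → Fin n} (hf : Function.Injective f) :
    0 < (C.submatrix id f).det * vdm (fun t => ((f t : ℕ) : ℝ)) := by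
  obtain ⟨σ, hσ⟩ := exists_perm_strictMono hf
  rw [← det_mul_vdm_perm C f σ]
  exact mul_pos (hC _ hσ) (vdm_pos hσ)

lemma det_submatrix_of_not_injective {p n : ℕ} (C : Matrix (Fin p) (Fin n) ℝ)
    {f : Fin p → Fin n} (hf : ¬ Function.Injective f) : (C.submatrix id f).det = 0 := by
  simp only [Function.Injective, not_forall] at hf
  obtain ⟨i, j, h, hne⟩ := hf
  exact Matrix.det_zero_of_column_eq hne (fun r => by simp [h])

/-- Expansion of a multilinear map along the rows of a matrix product. -/
lemma multilinear_mul_expand {k n : ℕ} {V : Type*} [AddCommGroup V] [Module ℝ V]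
    (g : MultilinearMap ℝ (fun _ : Fin k => V) ℝ)
    (C : Matrix (Fin k) (Fin n) ℝ) (z : Fin n → V) :
    g (fun t => ∑ j, C t j • z j) = ∑ f : Fin k → Fin n, (∏ t, C t (f t)) * g (z ∘ f) := by
  rw [g.map_sum]
  refine Finset.sum_congr rfl fun f _ => ?_
  exact g.map_smul_univ _ _

/-- A symmetrised Cauchy-Binet formula for alternating maps. -/
lemma cauchyBinet {k n : ℕ} {V : Type*} [AddCommGroup V] [Module ℝ V]
    (g : V [⋀^Fin k]→ₗ[ℝ] ℝ) (C : Matrix (Fin k) (Fin n) ℝ) (z : Fin n → V) :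
    (k.factorial : ℝ) * g (fun t => ∑ j, C t j • z j) =
      ∑ f : Fin k → Fin n, (C.submatrix id f).det * g (z ∘ f) := by
  have key : ∀ σ : Equiv.Perm (Fin k), g (fun t => ∑ j, C t j • z j) =
      ∑ f : Fin k → Fin n, ((Equiv.Perm.sign σ : ℤ) : ℝ) * (∏ t, C t (f (σ t))) * g (z ∘ f) := by
    intro σ
    have h := multilinear_mul_expand g.toMultilinearMap C z
    refine h.trans ?_
    rw [← Equiv.sum_comp (Equiv.arrowCongr σ.symm (Equiv.refl (Fin n)))]
    refine Finset.sum_congr rfl fun f _ => ?_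
    have h2 : z ∘ (Equiv.arrowCongr σ.symm (Equiv.refl (Fin n)) f) = (z ∘ f) ∘ σ := by
      ext t; simp [Equiv.arrowCongr]
    rw [h2]
    have h3 := g.map_perm (z ∘ f) σ
    simp only [AlternatingMap.coe_multilinearMap, h3, Units.smul_def, zsmul_eq_mul]
    simp [Equiv.arrowCongr]
    ring
  have : (k.factorial : ℝ) * g (fun t => ∑ j, C t j • z j) =
      ∑ σ : Equiv.Perm (Fin k), g (fun t => ∑ j, C t j • z j) := by
    simp [Fintype.card_perm]
  rw [this, Finset.sum_congr rfl fun σ _ => key σ, Finset.sum_comm]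
  refine Finset.sum_congr rfl fun f _ => ?_
  rw [← Finset.sum_mul, ← Matrix.det_transpose, Matrix.det_apply']
  rfl

lemma mul_row_eq {k n p : ℕ} (C : Matrix (Fin k) (Fin n) ℝ) (Z : Matrix (Fin n) (Fin p) ℝ)
    (t : Fin k) : (C * Z) t = ∑ j, C t j • Z j := by
  ext c
  simp [Matrix.mul_apply]

/-- The sign of the twistor coordinates of `C * Z` for positive `C`, `Z`, provided all factors
`(a - j) (b - j)` contribute the same sign `s`. -/
lemma twist_mul_pos {k n : ℕ} (hkn : k + 2 ≤ n) {C : Matrix (Fin k) (Fin n) ℝ}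
    {Z : Matrix (Fin n) (Fin (k + 2)) ℝ} (hC : MinorsPos C) (hZ : posMaxMinors Z)
    (a b : Fin n) (hab : a ≠ b) (s : ℝ)
    (hs : ∀ j : Fin n, j ≠ a → j ≠ b → 0 < s * (((a : ℕ) - (j : ℕ) : ℝ) * ((b : ℕ) - (j : ℕ)))) :
    0 < s ^ k * ((b : ℕ) - (a : ℕ) : ℝ) * twist (C * Z) ![Z a, Z b] := by
  have hcb := cauchyBinet (twistAlt ![Z a, Z b]) C (fun j => Z j)
  have hl : twistAlt ![Z a, Z b] (fun t => ∑ j, C t j • Z j) = twist (C * Z) ![Z a, Z b] := by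
    show twist _ _ = _
    congr 1
    ext t c
    simp [Matrix.mul_apply]
  rw [hl] at hcb
  have hterm : ∀ f : Fin k → Fin n, (twistAlt ![Z a, Z b] ((fun j => Z j) ∘ f)) =
      (Z.transpose.submatrix id (Fin.append f ![a, b])).det := by
    intro f
    rw [← Matrix.det_transpose]
    show Matrix.det _ = Matrix.det _
    congr 1
    ext t c
    refine Fin.addCases (fun i => ?_) (fun i => ?_) t
    · simp [Matrix.transpose]
    · fin_cases i <;> simp [Matrix.transpose]
  have hinj : ∀ f : Fin k → Fin n, Function.Injective (Fin.append f ![a, b]) ↔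
      Function.Injective f ∧ ∀ t, f t ≠ a ∧ f t ≠ b := by
    intro f
    rw [Fin.append_injective_iff]
    constructor
    · rintro ⟨h1, h2, h3⟩
      exact ⟨h1, fun t => ⟨by simpa using h3 t 0, by simpa using h3 t 1⟩⟩
    · rintro ⟨h1, h2⟩
      refine ⟨h1, ?_, ?_⟩
      · intro i j; fin_cases i <;> fin_cases j <;> simp [hab, hab.symm]
      · intro t i; fin_cases i
        · simpa using (h2 t).1
        · simpa using (h2 t).2
  have hpos : ∀ f : Fin k → Fin n, Function.Injective (Fin.append f ![a, b]) →
      0 < s ^ k * ((b : ℕ) - (a : ℕ) : ℝ) * ((C.submatrix id f).det *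
        (twistAlt ![Z a, Z b] ((fun j => Z j) ∘ f))) := by
    intro f hf
    have h1 := hC.det_mul_vdm ((hinj f).1 hf).1
    have h2 := hZ.transpose.det_mul_vdm hf
    have h3 : (fun t => (((Fin.append f ![a, b] t : Fin n) : ℕ) : ℝ)) =
        Fin.append (fun t => ((f t : ℕ) : ℝ)) ![((a : ℕ) : ℝ), ((b : ℕ) : ℝ)] := by
      ext t
      refine Fin.addCases (fun i => ?_) (fun i => ?_) t
      · simp
      · fin_cases i <;> simp
    rw [h3, vdm_append] at h2
    rw [hterm]
    have h4 : 0 < s ^ k * ∏ t, ((((a : ℕ) : ℝ) - (f t : ℕ)) * (((b : ℕ) : ℝ) - (f t : ℕ))) := by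
      have : s ^ k = ∏ _t : Fin k, s := by simp
      rw [this, ← Finset.prod_mul_distrib]
      exact Finset.prod_pos fun t _ =>
        hs _ (((hinj f).1 hf).2 t).1 (((hinj f).1 hf).2 t).2
    set V := vdm (fun t => ((f t : ℕ) : ℝ))
    set P := ∏ t, ((((a : ℕ) : ℝ) - (f t : ℕ)) * (((b : ℕ) : ℝ) - (f t : ℕ)))
    set c := (C.submatrix id f).det
    set z := (Z.transpose.submatrix id (Fin.append f ![a, b])).det
    have h5 : 0 < (s ^ k * (((b : ℕ) : ℝ) - (a : ℕ)) * (c * z)) * (V * P) ^ 2 := by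
      have := mul_pos (mul_pos h1 h2) h4
      have hV : V ≠ 0 := fun h => by simp [h] at h1
      have hP : P ≠ 0 := fun h => by simp [h] at h4
      have e : (c * V * (z * (V * P * (((b : ℕ) : ℝ) - (a : ℕ)))) * (s ^ k * P)) =
        (s ^ k * (((b : ℕ) : ℝ) - (a : ℕ)) * (c * z)) * (V * P) ^ 2 := by ring
      rwa [e] at this
    exact pos_of_mul_pos_left h5 (sq_nonneg _)
  have hsum : 0 < s ^ k * ((b : ℕ) - (a : ℕ) : ℝ) * ((k.factorial : ℝ) *
      twist (C * Z) ![Z a, Z b]) := by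
    rw [hcb, Finset.mul_sum]
    refine Finset.sum_pos' (fun f _ => ?_) ?_
    · by_cases hf : Function.Injective (Fin.append f ![a, b])
      · exact (hpos f hf).le
      · rw [hterm, det_submatrix_of_not_injective _ hf]; simp
    · have hcard : k ≤ (({a, b} : Finset (Fin n))ᶜ).card := by
        rw [Finset.card_compl, Finset.card_pair hab]; simp; omega
      obtain ⟨S, hS, hSc⟩ := Finset.exists_subset_card_eq hcard
      refine ⟨S.orderEmbOfFin hSc, Finset.mem_univ _, hpos _ ((hinj _).2
        ⟨(S.orderEmbOfFin hSc).injective, fun t => ?_⟩)⟩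
      have := hS (S.orderEmbOfFin_mem hSc t)
      simpa using this
  have hk0 : (0 : ℝ) < k.factorial := by exact_mod_cast k.factorial_pos
  have e : s ^ k * ((b : ℕ) - (a : ℕ) : ℝ) * ((k.factorial : ℝ) * twist (C * Z) ![Z a, Z b]) =
    (s ^ k * ((b : ℕ) - (a : ℕ) : ℝ) * twist (C * Z) ![Z a, Z b]) * k.factorial := by ring
  rw [e] at hsum
  exact pos_of_mul_pos_left hsum hk0.le

/-- A vector of the row span of a matrix with positive maximal minors that weakly alternates on
`k + 1` increasing positions vanishes there. -/
lemma MinorsPos.eq_zero_of_alternating {k n : ℕ} {C : Matrix (Fin k) (Fin n) ℝ}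
    (hC : MinorsPos C) (x : Fin k → ℝ) {g : Fin (k + 1) → Fin n} (hg : StrictMono g)
    (halt : ∀ i : Fin (k + 1), 0 ≤ (-1 : ℝ) ^ (i : ℕ) * (Matrix.vecMul x C) (g i))
    (i : Fin (k + 1)) :
    (Matrix.vecMul x C) (g i) = 0 := by
  let N : Matrix (Fin (k + 1)) (Fin (k + 1)) ℝ :=
    Matrix.of fun i => Fin.cons (Matrix.vecMul x C (g i)) (fun r => C r (g i))
  have hdet : N.det = 0 := by
    rw [← Matrix.exists_mulVec_eq_zero_iff]
    refine ⟨Fin.cons 1 (-x), fun h => by simpa using congrFun h 0, ?_⟩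
    ext i
    simp [N, Matrix.mulVec, dotProduct, Fin.sum_univ_succ, Matrix.vecMul, mul_comm]
  have hminor : ∀ i : Fin (k + 1), 0 < (N.submatrix i.succAbove Fin.succ).det := by
    intro i
    have h := hC (g ∘ i.succAbove) (hg.comp (Fin.strictMono_succAbove i))
    rw [← Matrix.det_transpose] at h
    exact h
  rw [Matrix.det_succ_column_zero] at hdet
  have hnn : ∀ i ∈ (Finset.univ : Finset (Fin (k + 1))), 0 ≤ (-1 : ℝ) ^ (i : ℕ) * N i 0 *
      (N.submatrix i.succAbove Fin.succ).det := fun i _ =>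
    mul_nonneg (by simpa [N] using halt i) (hminor i).le
  have h := (Finset.sum_eq_zero_iff_of_nonneg hnn).1 hdet i (Finset.mem_univ _)
  have h1 : N i 0 = Matrix.vecMul x C (g i) := by simp [N]
  rw [h1] at h
  have := (hminor i).ne'
  simpa [this] using h

/-- The number of sign flips of `v` in the positions `0, ..., N - 1`. -/
def flips (v : ℕ → ℝ) (N : ℕ) : ℕ := ((Finset.range N).filter fun i => v i * v (i + 1) < 0).card

lemma flips_zero (v : ℕ → ℝ) : flips v 0 = 0 := rfl

lemma flips_succ (v : ℕ → ℝ) (N : ℕ) :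
    flips v (N + 1) = flips v N + if v N * v (N + 1) < 0 then 1 else 0 := by
  unfold flips
  rw [Finset.range_add_one, Finset.filter_insert]
  split_ifs with h
  · rw [Finset.card_insert_of_notMem (by simp)]
  · simp

lemma flips_mono (v : ℕ → ℝ) : Monotone (flips v) := by
  refine monotone_nat_of_le_succ fun N => ?_
  rw [flips_succ]; omega

lemma flips_succ_le (v : ℕ → ℝ) (N : ℕ) : flips v (N + 1) ≤ flips v N + 1 := by
  rw [flips_succ]; split_ifs <;> omega

lemma sign_flips {v : ℕ → ℝ} {N : ℕ} (hv : ∀ i < N, v i ≠ 0) :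
    ∀ j < N, 0 < (-1 : ℝ) ^ flips v j * v 0 * v j := by
  intro j
  induction j with
  | zero =>
    intro h
    simp [flips_zero, mul_self_pos.2 (hv 0 h)]
  | succ j ih =>
    intro h
    have h0 := ih (by omega)
    have hj := hv j (by omega)
    have hj1 := hv (j + 1) h
    have hsq : 0 < v j ^ 2 := by positivity
    rw [flips_succ]
    split_ifs with hf
    · have : 0 < ((-1 : ℝ) ^ (flips v j + 1) * v 0 * v (j + 1)) * v j ^ 2 := by
        have := mul_pos_of_neg_of_neg (neg_lt_zero.2 h0) hf
        calc _ < _ := this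
          _ = _ := by ring
      exact pos_of_mul_pos_left this hsq.le
    · have hf' : 0 < v j * v (j + 1) :=
        lt_of_le_of_ne (not_lt.1 hf) (mul_ne_zero hj hj1).symm
      have : 0 < ((-1 : ℝ) ^ (flips v j + 0) * v 0 * v (j + 1)) * v j ^ 2 := by
        have := mul_pos h0 hf'
        calc _ < _ := this
          _ = _ := by rw [add_zero]; ring
      exact pos_of_mul_pos_left this hsq.le

lemma exists_eq_of_step {b : ℕ → ℕ} (h0 : b 0 = 0) (hb : ∀ i, b (i + 1) ≤ b i + 1) (N t : ℕ)
    (ht : t ≤ b N) : ∃ j ≤ N, b j = t := by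
  induction N with
  | zero => exact ⟨0, le_rfl, by omega⟩
  | succ N ih =>
    by_cases h : t ≤ b N
    · obtain ⟨j, hj, rfl⟩ := ih h; exact ⟨j, by omega, rfl⟩
    · exact ⟨N + 1, le_rfl, by have := hb N; omega⟩

/-- Positions realising the first `m + 1` values of a monotone unit-step function. -/
lemma exists_strictMono_step {b : ℕ → ℕ} (h0 : b 0 = 0) (hb : ∀ i, b (i + 1) ≤ b i + 1)
    (hm : Monotone b) {m N : ℕ} (hN : ∀ t < m, t ≤ b N) :
    ∃ g : Fin m → ℕ, StrictMono g ∧ ∀ t, g t ≤ N ∧ b (g t) = t := by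
  choose g hg1 hg2 using fun t : Fin m => exists_eq_of_step h0 hb N t (hN t t.2)
  refine ⟨g, fun s t hst => ?_, fun t => ⟨hg1 t, hg2 t⟩⟩
  by_contra h
  have := hm (not_lt.1 h)
  rw [hg2, hg2] at this
  exact absurd hst (by rw [Fin.lt_def]; omega)

lemma exists_alternating {v : ℕ → ℝ} {N m : ℕ} (hN : 0 < N) (hv : ∀ i < N, v i ≠ 0)
    (hm : m ≤ flips v (N - 1)) :
    ∃ g : Fin (m + 1) → ℕ, StrictMono g ∧ (∀ t, g t < N) ∧
      ∀ t : Fin (m + 1), 0 < (-1 : ℝ) ^ (t : ℕ) * v 0 * v (g t) := by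
  obtain ⟨g, hg, h⟩ := exists_strictMono_step (flips_zero v) (flips_succ_le v) (flips_mono v)
    (m := m + 1) (N := N - 1) (fun t ht => by omega)
  have hlt : ∀ t, g t < N := fun t => by have := (h t).1; omega
  refine ⟨g, hg, hlt, fun t => ?_⟩
  have := sign_flips hv (g t) (hlt t)
  rwa [(h t).2] at this

/-- A nowhere vanishing vector in the kernel of a matrix with positive maximal minors has at
least `k` sign flips. -/
lemma MinorsPos.le_flips {k n : ℕ} {C : Matrix (Fin k) (Fin n) ℝ} (hk : 1 ≤ k) (hkn : k ≤ n)
    (hC : MinorsPos C) {v : ℕ → ℝ} (hv : ∀ i < n, v i ≠ 0)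
    (hker : ∀ r, ∑ j : Fin n, C r j * v j = 0) : k ≤ flips v (n - 1) := by
  by_contra hlt
  rw [not_le] at hlt
  set b : ℕ → ℕ := fun j => max (flips v j) (j + k - n) with hb
  have hb0 : b 0 = 0 := by simp [hb, flips_zero]; omega
  have hbs : ∀ i, b (i + 1) ≤ b i + 1 := fun i => by
    have := flips_succ_le v i; simp only [hb]; omega
  have hbm : Monotone b := monotone_nat_of_le_succ fun i => by
    have := flips_mono v (Nat.le_succ i); simp only [hb]; simp at this; omega
  have hbk : ∀ j < n, b j < k := fun j hj => by
    have := flips_mono v (show j ≤ n - 1 by omega); simp only [hb]; omega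
  have hfib' : ∀ j j', j ≤ j' → b j = b j' → flips v j = flips v j' := by
    intro j j' hjj hbb
    have := flips_mono v hjj
    simp only [hb] at hbb
    rcases hjj.lt_or_eq with h | rfl
    · omega
    · rfl
  have hfib : ∀ j j', b j = b j' → flips v j = flips v j' := by
    intro j j' h
    rcases le_total j j' with h' | h'
    · exact hfib' j j' h' h
    · exact (hfib' j' j h' h.symm).symm
  obtain ⟨g, hg, hgb⟩ := exists_strictMono_step hb0 hbs hbm (m := k) (N := n - 1)
    (fun t ht => by simp only [hb]; omega)
  have hgn : ∀ t, g t < n := fun t => by have := (hgb t).1; omega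
  let D : Matrix (Fin n) (Fin k) ℝ := Matrix.of fun j t => if b j = t then |v j| else 0
  let e : Fin k → ℝ := fun t => SignType.sign (v (g t))
  have hDe : ∀ j : Fin n, ∑ t, D j t * e t = v j := by
    intro j
    have h1 := sign_flips hv j j.2
    have h2 := sign_flips hv (g ⟨b j, hbk j j.2⟩) (hgn _)
    rw [hfib (g ⟨b j, hbk j j.2⟩) j (hgb _).2] at h2
    have h3 : 0 < v j * v (g ⟨b j, hbk j j.2⟩) := by
      have h4 := mul_pos h1 h2
      have h5 : (-1 : ℝ) ^ flips v j * (-1 : ℝ) ^ flips v j = 1 := by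
        rw [← mul_pow]; simp
      have h6 : 0 < (v j * v (g ⟨b j, hbk j j.2⟩)) * v 0 ^ 2 := by
        calc _ < _ := h4
          _ = ((-1 : ℝ) ^ flips v j * (-1 : ℝ) ^ flips v j) *
            ((v j * v (g ⟨b j, hbk j j.2⟩)) * v 0 ^ 2) := by ring
          _ = _ := by rw [h5, one_mul]
      exact pos_of_mul_pos_left h6 (sq_nonneg _)
    rw [Finset.sum_eq_single ⟨b j, hbk j j.2⟩]
    · simp only [D, Matrix.of_apply, if_true, e]
      have hs : SignType.sign (v (g ⟨b j, hbk j j.2⟩)) = SignType.sign (v j) := by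
        rcases pos_and_pos_or_neg_and_neg_of_mul_pos h3 with ⟨p, q⟩ | ⟨p, q⟩
        · rw [sign_pos p, sign_pos q]
        · rw [sign_neg p, sign_neg q]
      rw [hs]
      exact abs_mul_sign (v j)
    · intro t _ ht
      have : b j ≠ t := fun h => ht (Fin.ext h.symm)
      simp [D, this]
    · simp
  have hdet : (C * D).det = 0 := by
    rw [← Matrix.exists_mulVec_eq_zero_iff]
    refine ⟨e, fun h => ?_, ?_⟩
    · have h1 : e ⟨0, hk⟩ = 0 := congrFun h _
      have h2 := hv _ (hgn ⟨0, hk⟩)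
      rcases h2.lt_or_gt with h3 | h3 <;> simp [e, h3] at h1
    · rw [← Matrix.mulVec_mulVec]
      have : Matrix.mulVec D e = fun j : Fin n => v j := by
        ext j; exact hDe j
      rw [this]; ext r; exact hker r
  have hexp : (C * D).det = ∑ f : Fin k → Fin n, (∏ t, D (f t) t) * (C.submatrix id f).det := by
    rw [← Matrix.det_transpose, Matrix.transpose_mul]
    have h := multilinear_mul_expand
      (Matrix.detRowAlternating (R := ℝ) (n := Fin k)).toMultilinearMap D.transpose
      (fun j => C.transpose j)
    have h1 : (D.transpose * C.transpose).det = (Matrix.detRowAlternating (R := ℝ)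
      (n := Fin k)).toMultilinearMap (fun t => ∑ j, D.transpose t j • C.transpose j) := by
      show Matrix.det _ = Matrix.det _
      congr 1
      ext t c
      simp [Matrix.mul_apply]
    rw [h1, h]
    refine Finset.sum_congr rfl fun f _ => ?_
    congr 1
    rw [← Matrix.det_transpose]
    rfl
  have hpos : 0 < (C * D).det := by
    rw [hexp]
    refine Finset.sum_pos' (fun f _ => ?_) ⟨fun t => ⟨g t, hgn t⟩, Finset.mem_univ _, ?_⟩
    · by_cases hf : ∀ t, b (f t) = t
      · refine mul_nonneg (Finset.prod_nonneg fun t _ => ?_) (hC f fun s t hst => ?_).le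
        · simp only [D, Matrix.of_apply]; split_ifs <;> simp
        · by_contra h
          have h2 : b (f t) ≤ b (f s) := hbm (Fin.le_def.1 (not_lt.1 h))
          rw [hf, hf] at h2
          exact absurd hst (by rw [Fin.lt_def]; omega)
      · push Not at hf
        obtain ⟨t, ht⟩ := hf
        have : (∏ t, D (f t) t) = 0 :=
          Finset.prod_eq_zero (Finset.mem_univ t) (by simp [D, ht])
        simp [this]
    · refine mul_pos (Finset.prod_pos fun t _ => ?_) (hC _ fun s t hst => ?_)
      · simp [D, (hgb t).2, hv _ (hgn t)]
      · exact hg hst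
  exact hpos.ne' hdet

/-- A nonzero vector in the kernel of a matrix with positive maximal minors strictly alternates
on some `p + 1` increasing positions. -/
lemma MinorsPos.exists_alternating_of_ker {p n : ℕ} {C : Matrix (Fin p) (Fin n) ℝ} (hp : 1 ≤ p)
    (hpn : p ≤ n) (hC : MinorsPos C) {c : Fin n → ℝ} (hc : c ≠ 0) (hker : C.mulVec c = 0) :
    ∃ (g : Fin (p + 1) → Fin n) (s : ℝ), StrictMono g ∧
      ∀ t : Fin (p + 1), 0 < (-1 : ℝ) ^ (t : ℕ) * (s * c (g t)) := by
  classical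
  set S : Finset (Fin n) := Finset.univ.filter fun j => c j ≠ 0 with hS
  have hsum : ∀ (T : Finset (Fin n)), S ⊆ T → ∀ (q : ℕ) (hT : T.card = q) (r : Fin p),
      ∑ i : Fin q, C r (T.orderEmbOfFin hT i) * c (T.orderEmbOfFin hT i) = 0 := by
    intro T hST q hT r
    have h1 : ∑ j ∈ T, C r j * c j = 0 := by
      have h0 : ∑ j, C r j * c j = 0 := congrFun hker r
      rw [← h0]
      refine Finset.sum_subset (Finset.subset_univ _) fun j _ hj => ?_
      have : c j = 0 := by
        by_contra h; exact hj (hST (by simp [hS, h]))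
      simp [this]
    rw [← h1]
    conv_rhs => rw [← Finset.map_orderEmbOfFin_univ T hT, Finset.sum_map]
    rfl
  rcases le_or_gt p S.card with h | h
  · set e := S.orderEmbOfFin rfl with he
    have hne : ∀ i, c (e i) ≠ 0 := fun i => by
      exact (Finset.mem_filter.1 (S.orderEmbOfFin_mem rfl i)).2
    set v : ℕ → ℝ := fun i => if h : i < S.card then c (e ⟨i, h⟩) else 0 with hv
    have hvf : ∀ i : Fin S.card, v i = c (e i) := fun i => by simp [hv]
    have hv0 : ∀ i < S.card, v i ≠ 0 := fun i hi => by
      rw [hvf ⟨i, hi⟩]; exact hne _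
    have hC' : MinorsPos (C.submatrix id e) := fun f hf => hC (e ∘ f) (e.strictMono.comp hf)
    have hfl := hC'.le_flips hp h hv0 (fun r => by
      simp only [hvf]; exact hsum S subset_rfl _ rfl r)
    obtain ⟨g, hg, hgl, hga⟩ := exists_alternating (by omega) hv0 hfl
    refine ⟨fun t => e ⟨g t, hgl t⟩, v 0, fun s t hst => e.strictMono (hg hst), fun t => ?_⟩
    have := hga t
    rw [hvf ⟨g t, hgl t⟩] at this
    rwa [← mul_assoc]
  · exfalso
    obtain ⟨T, hST, hT⟩ := Finset.exists_superset_card_eq h.le (by simpa using hpn)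
    have hd := hC _ (T.orderEmbOfFin hT).strictMono
    refine hd.ne' (Matrix.exists_mulVec_eq_zero_iff.1
      ⟨fun i => c (T.orderEmbOfFin hT i), fun h0 => hc ?_, ?_⟩)
    · ext j
      by_contra hj
      have hjT : j ∈ T := hST (by simpa [hS] using hj)
      rw [← Finset.image_orderEmbOfFin_univ T hT] at hjT
      obtain ⟨i, -, rfl⟩ := Finset.mem_image.1 hjT
      exact hj (congrFun h0 i)
    · ext r
      exact hsum T hST p hT r

lemma rows_independent_iff {k n : ℕ} (C : Matrix (Fin k) (Fin n) ℝ) :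
    LinearIndependent ℝ (fun i => C i) ↔ ∀ x : Fin k → ℝ, Matrix.vecMul x C = 0 → x = 0 := by
  rw [show (fun i => C i) = C.row from rfl, ← Matrix.vecMul_injective_iff]
  exact injective_iff_map_eq_zero C.vecMulLinear

lemma span_rows_le_iff {k l n : ℕ} (E : Matrix (Fin k) (Fin n) ℝ) (M : Matrix (Fin l) (Fin n) ℝ) :
    Submodule.span ℝ (Set.range (fun i => E i)) ≤ Submodule.span ℝ (Set.range (fun i => M i)) ↔
      ∃ X : Matrix (Fin k) (Fin l) ℝ, E = X * M := by
  have h : Submodule.span ℝ (Set.range (fun i => M i)) = LinearMap.range M.vecMulLinear :=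
    (range_vecMulLinear M).symm
  rw [Submodule.span_le, h]
  constructor
  · intro H
    choose x hx using fun i => H ⟨i, rfl⟩
    refine ⟨Matrix.of x, ?_⟩
    ext i j
    exact (congrFun (hx i) j).symm
  · rintro ⟨X, rfl⟩ _ ⟨i, rfl⟩
    exact ⟨X i, rfl⟩

lemma exists_det_ne_zero {k n : ℕ} {C : Matrix (Fin k) (Fin n) ℝ}
    (hC : LinearIndependent ℝ (fun i => C i)) :
    ∃ f : Fin k → Fin n, StrictMono f ∧ (C.submatrix id f).det ≠ 0 := by
  have hinj : Function.Injective C.vecMul := by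
    rw [Matrix.vecMul_injective_iff]; exact hC
  have hd := (Matrix.PosDef.mul_conjTranspose_self C hinj).det_pos
  have hex : ∃ f : Fin k → Fin n, (C.submatrix id f).det ≠ 0 := by
    by_contra! hno
    have h := multilinear_mul_expand
      (Matrix.detRowAlternating (R := ℝ) (n := Fin k)).toMultilinearMap C
      (fun j => C.transpose j)
    have h1 : (C * C.conjTranspose).det = (Matrix.detRowAlternating (R := ℝ)
      (n := Fin k)).toMultilinearMap (fun t => ∑ j, C t j • C.transpose j) := by
      show Matrix.det _ = Matrix.det _
      congr 1
      ext t c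
      simp [Matrix.mul_apply]
    rw [h1, h] at hd
    refine hd.ne' (Finset.sum_eq_zero fun f _ => ?_)
    have := hno f
    rw [← Matrix.det_transpose] at this
    exact mul_eq_zero_of_right _ this
  obtain ⟨f, hf⟩ := hex
  have hfi : Function.Injective f := by
    by_contra h; exact hf (det_submatrix_of_not_injective C h)
  obtain ⟨σ, hσ⟩ := exists_perm_strictMono hfi
  refine ⟨f ∘ σ, hσ, fun h => ?_⟩
  have h2 := det_mul_vdm_perm C f σ
  have hv := (vdm_pos hσ).ne'
  rw [h, zero_mul, eq_comm, mul_eq_zero] at h2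
  rcases h2 with h2 | h2
  · exact hf h2
  · have h3 := vdm_comp_perm (fun t => ((f t : ℕ) : ℝ)) σ
    rw [h2, mul_zero] at h3
    exact hv h3

lemma MinorsPos.rows_independent {k n : ℕ} (hkn : k ≤ n) {C : Matrix (Fin k) (Fin n) ℝ}
    (hC : MinorsPos C) : LinearIndependent ℝ (fun i => C i) := by
  rw [rows_independent_iff]
  intro x hx
  by_contra hne
  refine (hC (Fin.castLE hkn) (Fin.strictMono_castLE hkn)).ne'
    (Matrix.exists_vecMul_eq_zero_iff.1 ⟨x, hne, ?_⟩)
  ext j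
  exact congrFun hx (Fin.castLE hkn j)

/-- Adding `ε` times column `j'` to column `j`. -/
def addCol {k n : ℕ} (C : Matrix (Fin k) (Fin n) ℝ) (j j' : Fin n) (ε : ℝ) :
    Matrix (Fin k) (Fin n) ℝ :=
  C.updateCol j ((fun r => C r j) + ε • fun r => C r j')

lemma addCol_zero {k n : ℕ} (C : Matrix (Fin k) (Fin n) ℝ) (j j' : Fin n) :
    addCol C j j' 0 = C := by
  simp [addCol]

lemma continuous_addCol {k n : ℕ} (C : Matrix (Fin k) (Fin n) ℝ) (j j' : Fin n) :
    Continuous (addCol C j j') := by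
  unfold addCol
  exact continuous_const.matrix_updateCol j (by fun_prop)

lemma det_addCol_of_notMem {k n : ℕ} (C : Matrix (Fin k) (Fin n) ℝ) {j j' : Fin n} {ε : ℝ}
    {f : Fin k → Fin n} (hf : ∀ t, f t ≠ j) :
    ((addCol C j j' ε).submatrix id f).det = (C.submatrix id f).det := by
  congr 1
  ext r t
  simp [addCol, Matrix.updateCol_ne (hf t)]

lemma det_addCol_of_mem {k n : ℕ} (C : Matrix (Fin k) (Fin n) ℝ) (j' : Fin n) (ε : ℝ)
    {f : Fin k → Fin n} (hf : Function.Injective f) (t : Fin k) :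
    ((addCol C (f t) j' ε).submatrix id f).det = (C.submatrix id f).det +
      ε * (C.submatrix id (Function.update f t j')).det := by
  have h1 : (addCol C (f t) j' ε).submatrix id f = (C.submatrix id f).updateCol t
      ((fun r => C r (f t)) + ε • fun r => C r j') := by
    ext r s
    by_cases h : s = t
    · subst h; simp [addCol]
    · have : f s ≠ f t := fun h' => h (hf h')
      simp [addCol, Matrix.updateCol_ne h, Matrix.updateCol_ne this]
  rw [h1, Matrix.det_updateCol_add, Matrix.det_updateCol_smul]
  congr 2
  · ext r s
    by_cases h : s = t
    · subst h; simp
    · simp [Matrix.updateCol_ne h]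
  · congr 1
    ext r s
    by_cases h : s = t
    · subst h; simp
    · simp [Matrix.updateCol_ne h, Function.update_of_ne h]

lemma strictMono_update {k n : ℕ} {f : Fin k → Fin n} (hf : StrictMono f) (t : Fin k)
    {j : Fin n} (hj : (j : ℕ) + 1 = f t ∨ (f t : ℕ) + 1 = j) (hjf : ∀ s, f s ≠ j) :
    StrictMono (Function.update f t j) := by
  intro a b hab
  have hfab : (f a : ℕ) < f b := hf hab
  have hva : (f a : ℕ) ≠ j := fun h => hjf a (Fin.ext h)
  have hvb : (f b : ℕ) ≠ j := fun h => hjf b (Fin.ext h)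
  rw [Fin.lt_def]
  by_cases ha : a = t
  · subst ha
    have hb : b ≠ a := hab.ne'
    rw [Function.update_self, Function.update_of_ne hb]
    omega
  · by_cases hb : b = t
    · subst hb
      rw [Function.update_self, Function.update_of_ne ha]
      omega
    · rw [Function.update_of_ne ha, Function.update_of_ne hb]
      exact hfab

lemma addCol_det_nonneg {k n : ℕ} {C : Matrix (Fin k) (Fin n) ℝ} (hC : MinorsNonneg C)
    {j j' : Fin n} (hj : (j' : ℕ) + 1 = j ∨ (j : ℕ) + 1 = j') {ε : ℝ} (hε : 0 < ε)
    {f : Fin k → Fin n} (hf : StrictMono f) :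
    (C.submatrix id f).det ≤ ((addCol C j j' ε).submatrix id f).det := by
  by_cases h : ∀ t, f t ≠ j
  · rw [det_addCol_of_notMem C h]
  · push Not at h
    obtain ⟨t, rfl⟩ := h
    rw [det_addCol_of_mem C j' ε hf.injective t]
    have : 0 ≤ (C.submatrix id (Function.update f t j')).det := by
      by_cases h' : ∀ s, f s ≠ j'
      · exact hC _ (strictMono_update hf t hj h')
      · push Not at h'
        obtain ⟨s, rfl⟩ := h'
        have hst : s ≠ t := by rintro rfl; omega
        refine (det_submatrix_of_not_injective C fun hinj => hst (hinj ?_)).ge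
        simp [Function.update_of_ne hst]
    nlinarith

/-- A property of increasing tuples that is invariant under moving one entry by one step holds
for all of them or for none. -/
lemma strictMono_connected {k n : ℕ} (Q : (Fin k → Fin n) → Prop)
    (hQ : ∀ f, StrictMono f → Q f → ∀ (t : Fin k) (j : Fin n),
      ((j : ℕ) + 1 = f t ∨ (f t : ℕ) + 1 = j) → (∀ s, f s ≠ j) → Q (Function.update f t j))
    {f g : Fin k → Fin n} (hf : StrictMono f) (hg : StrictMono g) (hQf : Q f) : Q g := by
  have hkn : k ≤ n := by simpa using Fintype.card_le_of_injective f hf.injective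
  have key : ∀ (m : ℕ) (f : Fin k → Fin n), StrictMono f → ∑ t, (f t : ℕ) = m →
      (Q f ↔ Q (Fin.castLE hkn)) := by
    intro m
    induction m using Nat.strong_induction_on with
    | _ m ih =>
      intro f hf hm
      by_cases hall : ∀ t, (f t : ℕ) = t
      · rw [show f = Fin.castLE hkn from funext fun t => Fin.ext (hall t)]
      · push Not at hall
        obtain ⟨t, ht, hmin⟩ : ∃ t, (f t : ℕ) ≠ t ∧ ∀ s < t, (f s : ℕ) = s := by
          obtain ⟨t, ht⟩ := WellFounded.has_min (wellFounded_lt (α := Fin k))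
            {t | (f t : ℕ) ≠ t} hall
          exact ⟨t, ht.1, fun s hs => by
            by_contra h; exact ht.2 s h hs⟩
        have hgt : (t : ℕ) < f t := by
          refine lt_of_le_of_ne ?_ ht.symm
          rcases Nat.eq_zero_or_pos (t : ℕ) with h | h
          · omega
          · have hs : (⟨t - 1, by omega⟩ : Fin k) < t := by rw [Fin.lt_def]; simp; omega
            have h1 := hmin _ hs
            have h2 : (f ⟨t - 1, by omega⟩ : ℕ) < f t := hf hs
            simp only at h1
            omega
        set j : Fin n := ⟨f t - 1, by omega⟩ with hjdef
        have hjt : (j : ℕ) + 1 = f t := by simp [hjdef]; omega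
        have hjf : ∀ s, f s ≠ j := by
          intro s hs
          have hs' : (f s : ℕ) + 1 = f t := by rw [hs]; exact hjt
          rcases lt_trichotomy s t with h | rfl | h
          · have := hmin s h
            rw [Fin.lt_def] at h
            omega
          · omega
          · have h2 : (f t : ℕ) < f s := hf h
            omega
        have hsm := strictMono_update hf t (Or.inl hjt) hjf
        have hlt : ∑ s, (Function.update f t j s : ℕ) < ∑ s, (f s : ℕ) := by
          refine Finset.sum_lt_sum (fun s _ => ?_) ⟨t, Finset.mem_univ _, ?_⟩
          · by_cases h : s = t
            · subst h; rw [Function.update_self]; omega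
            · rw [Function.update_of_ne h]
          · rw [Function.update_self]; omega
        rw [← ih _ (by omega) _ hsm rfl]
        refine ⟨fun h => hQ f hf h t j (Or.inl hjt) hjf, fun h => ?_⟩
        have h3 := hQ _ hsm h t (f t) (by rw [Function.update_self]; omega) (fun s => ?_)
        · simpa using h3
        · by_cases hst : s = t
          · subst hst; rw [Function.update_self]; intro h'; rw [h'] at hjt; omega
          · rw [Function.update_of_ne hst]; exact fun h' => hst (hf.injective h')
  exact (key _ g hg rfl).2 ((key _ f hf rfl).1 hQf)

/-- Full-rank matrices with nonnegative maximal minors are limits of matrices with positive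
maximal minors. -/
lemma MinorsNonneg.mem_closure {k n : ℕ} {C : Matrix (Fin k) (Fin n) ℝ} (hC : MinorsNonneg C)
    (hrk : LinearIndependent ℝ (fun i => C i)) :
    C ∈ closure {C : Matrix (Fin k) (Fin n) ℝ | MinorsPos C} := by
  classical
  rw [mem_closure_iff]
  intro o ho hCo
  obtain ⟨f₀, hf₀, hdet₀⟩ := exists_det_ne_zero hrk
  have hpos₀ := lt_of_le_of_ne (hC f₀ hf₀) hdet₀.symm
  clear hrk hdet₀
  let bad : Matrix (Fin k) (Fin n) ℝ → Finset (Fin k → Fin n) := fun C =>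
    Finset.univ.filter fun f => StrictMono f ∧ (C.submatrix id f).det ≤ 0
  induction hm : (bad C).card using Nat.strong_induction_on generalizing C with
  | _ m ih =>
    by_cases hall : MinorsPos C
    · exact ⟨C, hCo, hall⟩
    · simp only [MinorsPos, not_forall, not_lt] at hall
      obtain ⟨g, hg, hgdet⟩ := hall
      obtain ⟨f, hf, hfpos, t, j, hjt, hjf, hbad⟩ : ∃ f, StrictMono f ∧
          0 < (C.submatrix id f).det ∧ ∃ (t : Fin k) (j : Fin n),
          ((j : ℕ) + 1 = f t ∨ (f t : ℕ) + 1 = j) ∧ (∀ s, f s ≠ j) ∧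
          (C.submatrix id (Function.update f t j)).det ≤ 0 := by
        by_contra! hno
        have := strictMono_connected (fun f => 0 < (C.submatrix id f).det)
          (fun f hf hp t j h1 h2 => hno f hf hp t j h1 h2) hf₀ hg hpos₀
        linarith
      have hev : ∀ᶠ ε in nhdsWithin (0 : ℝ) (Set.Ioi 0), addCol C j (f t) ε ∈ o := by
        refine nhdsWithin_le_nhds ?_
        refine (continuous_addCol C j (f t)).continuousAt.eventually_mem (ho.mem_nhds ?_)
        rwa [addCol_zero]
      obtain ⟨ε, hεo, hε⟩ := (hev.and self_mem_nhdsWithin).exists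
      have hε : 0 < ε := hε
      have hle : ∀ f', StrictMono f' → (C.submatrix id f').det ≤
          ((addCol C j (f t) ε).submatrix id f').det :=
        fun f' hf' => addCol_det_nonneg hC (hjt.symm) hε hf'
      refine ih _ ?_ (fun f' hf' => (hC f' hf').trans (hle f' hf')) hεo
        (hpos₀.trans_le (hle f₀ hf₀)) rfl
      rw [← hm]
      refine Finset.card_lt_card ⟨fun f' => ?_, fun hsub => ?_⟩
      · simp only [bad, Finset.mem_filter, Finset.mem_univ, true_and]
        exact fun ⟨h1, h2⟩ => ⟨h1, (hle f' h1).trans h2⟩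
      · have hsm := strictMono_update hf t hjt hjf
        have hmem : Function.update f t j ∈ bad C := by simp [bad, hsm, hbad]
        have h2 := (Finset.mem_filter.1 (hsub hmem)).2.2
        have h3 := det_addCol_of_mem C (f t) ε hsm.injective t
        rw [Function.update_self, Function.update_idem, Function.update_eq_self] at h3
        rw [h3] at h2
        have h4 := hC _ hsm
        nlinarith [mul_pos hε hfpos]

/-- The product of a full-rank nonnegative and a positive matrix has full rank. -/
lemma MinorsNonneg.mul_rows_independent {k n : ℕ} (hkn : k + 2 ≤ n)
    {C : Matrix (Fin k) (Fin n) ℝ} {Z : Matrix (Fin n) (Fin (k + 2)) ℝ} (hC : MinorsNonneg C)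
    (hrk : LinearIndependent ℝ (fun i => C i)) (hZ : posMaxMinors Z) :
    LinearIndependent ℝ (fun i => (C * Z) i) := by
  rw [rows_independent_iff]
  intro x hx
  by_contra hne
  have hc : Matrix.vecMul x C ≠ 0 := fun h => hne ((rows_independent_iff C).1 hrk x h)
  have hker : Z.transpose.mulVec (Matrix.vecMul x C) = 0 := by
    rw [Matrix.mulVec_transpose, Matrix.vecMul_vecMul, hx]
  obtain ⟨g, s, hg, halt⟩ := hZ.transpose.exists_alternating_of_ker (by omega) hkn hc hker
  have hopen : IsOpen {D : Matrix (Fin k) (Fin n) ℝ | ∀ t : Fin (k + 2 + 1),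
      0 < (-1 : ℝ) ^ (t : ℕ) * (s * (Matrix.vecMul x D) (g t))} := by
    simp only [Set.ofPred_forall]
    refine isOpen_iInter_of_finite fun t => isOpen_lt continuous_const ?_
    have : Continuous fun D : Matrix (Fin k) (Fin n) ℝ => Matrix.vecMul x D :=
      continuous_const.matrix_vecMul continuous_id
    fun_prop
  obtain ⟨D, hD, hDpos⟩ := mem_closure_iff.1 (hC.mem_closure hrk) _ hopen halt
  have h0 : ∀ i : Fin (k + 1), Matrix.vecMul (s • x) D (g (i.castLE (by omega))) =
      s * (Matrix.vecMul x D) (g (i.castLE (by omega))) := fun i => by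
    rw [Matrix.smul_vecMul]; rfl
  have h1 := MinorsPos.eq_zero_of_alternating hDpos (s • x)
    (g := fun i => g (i.castLE (by omega)))
    (hg.comp (Fin.strictMono_castLE (by omega : k + 1 ≤ k + 2 + 1)))
    (fun i => by rw [h0]; exact (hD (i.castLE (by omega))).le) 0
  rw [h0] at h1
  have h2 := hD ((0 : Fin (k + 1)).castLE (by omega))
  rw [h1] at h2
  simp at h2

lemma isOpen_minorsPos (k n : ℕ) : IsOpen {C : Matrix (Fin k) (Fin n) ℝ | MinorsPos C} := by
  simp only [MinorsPos, Set.ofPred_forall]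
  refine isOpen_iInter_of_finite fun f => isOpen_iInter_of_finite fun _ =>
    isOpen_lt continuous_const ?_
  exact (continuous_id.matrix_submatrix id f).matrix_det

lemma continuous_twist_mul {k n : ℕ} (Z : Matrix (Fin n) (Fin (k + 2)) ℝ)
    (u : Fin 2 → Fin (k + 2) → ℝ) :
    Continuous fun C : Matrix (Fin k) (Fin n) ℝ => twist (C * Z) u := by
  refine Continuous.matrix_det (continuous_matrix fun i j => ?_)
  refine Fin.addCases (fun i => ?_) (fun i => ?_) i
  · simp only [Matrix.of_apply, Fin.append_left]
    exact (continuous_id.matrix_mul continuous_const).matrix_elem i j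
  · simp only [Matrix.of_apply, Fin.append_right]
    exact continuous_const

lemma exists_twist_mul_ne_zero {k n : ℕ} (hkn : k + 2 ≤ n) {Z : Matrix (Fin n) (Fin (k + 2)) ℝ}
    (hZ : posMaxMinors Z) {a b : Fin n} (hab : a ≠ b) :
    ∃ C : Matrix (Fin k) (Fin n) ℝ, twist (C * Z) ![Z a, Z b] ≠ 0 := by
  have hcard : k ≤ (({a, b} : Finset (Fin n))ᶜ).card := by
    rw [Finset.card_compl, Finset.card_pair hab, Fintype.card_fin]; omega
  obtain ⟨S, hS, hSk⟩ := Finset.exists_subset_card_eq hcard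
  set g : Fin k → Fin n := fun t => (S.orderIsoOfFin hSk t).val with hg
  have hgS : ∀ t, g t ≠ a ∧ g t ≠ b := fun t => by
    have h : g t ∈ ({a, b} : Finset (Fin n))ᶜ := hS (S.orderIsoOfFin hSk t).2
    simpa using h
  have hginj : Function.Injective g := (strictMono_orderIso S hSk).injective
  refine ⟨Matrix.of fun t j => if g t = j then 1 else 0, ?_⟩
  have hM : (Matrix.of fun t j => if g t = j then (1 : ℝ) else 0) * Z = Z.submatrix g id := by
    ext t c
    simp [Matrix.mul_apply]
  have hinj : Function.Injective (Fin.append g ![a, b]) := by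
    rw [Fin.append_injective_iff]
    refine ⟨hginj, ?_, ?_⟩
    · intro i j h
      fin_cases i <;> fin_cases j <;> simp_all [eq_comm]
    · intro i j
      fin_cases j
      · exact (hgS i).1
      · exact (hgS i).2
  have ht : twist ((Matrix.of fun t j => if g t = j then (1 : ℝ) else 0) * Z) ![Z a, Z b] =
      (Z.transpose.submatrix id (Fin.append g ![a, b])).det := by
    rw [hM, ← Matrix.det_transpose, twist]
    congr 1
    ext i j
    rw [Matrix.transpose_submatrix, Matrix.transpose_transpose]
    refine Fin.addCases (fun i => ?_) (fun i => ?_) i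
    · simp
    · fin_cases i <;> simp [Fin.append_right]
  rw [ht]
  exact fun h0 => (hZ.transpose.det_mul_vdm hinj).ne' (by rw [h0, zero_mul])

lemma finite_det_add_smul_eq_zero {m : ℕ} (A B : Matrix (Fin m) (Fin m) ℝ) {r₀ : ℝ}
    (h : (A + r₀ • B).det ≠ 0) : {r : ℝ | (A + r • B).det = 0}.Finite := by
  set p : Polynomial ℝ :=
    (A.map Polynomial.C + (Polynomial.X : Polynomial ℝ) • B.map Polynomial.C).det with hp
  have heval : ∀ r, p.eval r = (A + r • B).det := fun r => by
    rw [hp, ← Polynomial.coe_evalRingHom, RingHom.map_det]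
    congr 1
    ext i j
    simp
    ring
  have hp0 : p ≠ 0 := fun h0 => h (by rw [← heval, h0, Polynomial.eval_zero])
  refine (p.roots.toFinset.finite_toSet).subset fun r hr => ?_
  simp [hp0, Polynomial.IsRoot, heval, show (A + r • B).det = 0 from hr]

lemma dense_twist_mul_ne_zero {k n : ℕ} (Z : Matrix (Fin n) (Fin (k + 2)) ℝ)
    (u : Fin 2 → Fin (k + 2) → ℝ) (h : ∃ C : Matrix (Fin k) (Fin n) ℝ, twist (C * Z) u ≠ 0) :
    Dense {C : Matrix (Fin k) (Fin n) ℝ | twist (C * Z) u ≠ 0} := by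
  obtain ⟨D, hD⟩ := h
  intro C
  set A : Matrix (Fin (k + 2)) (Fin (k + 2)) ℝ := Matrix.of (Fin.append (fun i => (C * Z) i) u)
  set B : Matrix (Fin (k + 2)) (Fin (k + 2)) ℝ :=
    Matrix.of (Fin.append (fun i => ((D - C) * Z) i) (0 : Fin 2 → Fin (k + 2) → ℝ))
  have hline : ∀ r : ℝ, twist ((C + r • (D - C)) * Z) u = (A + r • B).det := fun r => by
    rw [twist]
    congr 1
    ext i j
    refine Fin.addCases (fun i => ?_) (fun i => ?_) i
    · simp [A, B, Matrix.add_mul]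
    · simp [A, B, Fin.append_right]
  have hfin := finite_det_add_smul_eq_zero A B (r₀ := 1) (by rw [← hline]; simpa using hD)
  have h0 : (0 : ℝ) ∈ closure {r : ℝ | (A + r • B).det = 0}ᶜ :=
    hfin.countable.dense_compl ℝ 0
  have hcont : Continuous fun r : ℝ => C + r • (D - C) := by fun_prop
  have := map_mem_closure hcont h0 (t := {C | twist (C * Z) u ≠ 0})
    (fun r hr => by simpa [hline] using hr)
  simpa using this

/-- Positive matrices whose image under the amplituhedron map lies on none of the
hypersurfaces `⟨Y Z_a Z_b⟩ = 0`. -/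
def IsGeneric {k n : ℕ} (Z : Matrix (Fin n) (Fin (k + 2)) ℝ) (C : Matrix (Fin k) (Fin n) ℝ) :
    Prop :=
  MinorsPos C ∧ ∀ a b : Fin n, a ≠ b → twist (C * Z) ![Z a, Z b] ≠ 0

lemma MinorsNonneg.mem_closure_generic {k n : ℕ} (hkn : k + 2 ≤ n)
    {Z : Matrix (Fin n) (Fin (k + 2)) ℝ} (hZ : posMaxMinors Z) {C : Matrix (Fin k) (Fin n) ℝ}
    (hC : MinorsNonneg C) (hrk : LinearIndependent ℝ (fun i => C i)) :
    C ∈ closure {C | IsGeneric Z C} := by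
  have : BaireSpace (Matrix (Fin k) (Fin n) ℝ) :=
    inferInstanceAs (BaireSpace (Fin k → Fin n → ℝ))
  have hdense : Dense (⋂ p : {p : Fin n × Fin n // p.1 ≠ p.2},
      {C : Matrix (Fin k) (Fin n) ℝ | twist (C * Z) ![Z p.1.1, Z p.1.2] ≠ 0}) :=
    dense_iInter_of_isOpen (fun p => isOpen_ne_fun (continuous_twist_mul Z _) continuous_const)
      fun p => dense_twist_mul_ne_zero Z _ (exists_twist_mul_ne_zero hkn hZ p.2)
  have h1 := hdense.open_subset_closure_inter (isOpen_minorsPos k n)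
  have h2 := closure_minimal h1 isClosed_closure (hC.mem_closure hrk)
  refine closure_mono (t := {C | IsGeneric Z C}) (fun D hD => ⟨hD.1, fun a b hab => ?_⟩) h2
  exact Set.mem_iInter.1 hD.2 ⟨(a, b), hab⟩

lemma mul_transpose_det_ne_zero {k n : ℕ} {M : Matrix (Fin k) (Fin n) ℝ}
    (hM : LinearIndependent ℝ (fun i => M i)) : (M * M.transpose).det ≠ 0 := by
  have hinj : Function.Injective M.vecMul := by
    rw [Matrix.vecMul_injective_iff]; exact hM
  have := (Matrix.PosDef.mul_conjTranspose_self M hinj).det_pos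
  rw [Matrix.conjTranspose_eq_transpose_of_trivial] at this
  exact this.ne'

open scoped MatrixOrder Matrix.Norms.L2Operator in
lemma exists_orthonormalize {k n : ℕ} {C : Matrix (Fin k) (Fin n) ℝ}
    (hC : LinearIndependent ℝ (fun i => C i)) :
    ∃ G : Matrix (Fin k) (Fin k) ℝ, G.det ≠ 0 ∧ (G * C) * (G * C).transpose = 1 := by
  have hinj : Function.Injective C.vecMul := by
    rw [Matrix.vecMul_injective_iff]; exact hC
  have hpd := Matrix.PosDef.mul_conjTranspose_self C hinj
  obtain ⟨B, hB⟩ := CStarAlgebra.nonneg_iff_eq_star_mul_self.mp hpd.posSemidef.nonneg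
  rw [Matrix.conjTranspose_eq_transpose_of_trivial, Matrix.star_eq_conjTranspose,
    Matrix.conjTranspose_eq_transpose_of_trivial] at hB
  have hBdet : B.det ≠ 0 := by
    have h := mul_transpose_det_ne_zero hC
    rw [hB, Matrix.det_mul] at h
    exact right_ne_zero_of_mul h
  have hu : IsUnit B.det := hBdet.isUnit
  have hu' : IsUnit B.transpose.det := by rwa [Matrix.det_transpose]
  refine ⟨(B.transpose)⁻¹, (Matrix.isUnit_nonsing_inv_det _ hu').ne_zero, ?_⟩
  rw [Matrix.transpose_mul, Matrix.mul_assoc, ← Matrix.mul_assoc C, hB,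
    Matrix.transpose_nonsing_inv, Matrix.transpose_transpose, Matrix.mul_assoc, Matrix.mul_nonsing_inv _ hu, Matrix.mul_one,
    Matrix.nonsing_inv_mul _ hu']

lemma span_rows_mul_eq {k n : ℕ} {X : Matrix (Fin k) (Fin k) ℝ} (hX : X.det ≠ 0)
    (M : Matrix (Fin k) (Fin n) ℝ) :
    Submodule.span ℝ (Set.range (fun i => (X * M) i)) =
      Submodule.span ℝ (Set.range (fun i => M i)) := by
  refine le_antisymm ((span_rows_le_iff _ _).2 ⟨X, rfl⟩) ((span_rows_le_iff _ _).2 ⟨X⁻¹, ?_⟩)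
  rw [← Matrix.mul_assoc, Matrix.nonsing_inv_mul _ hX.isUnit, Matrix.one_mul]

lemma det_ne_zero_of_rows_independent_mul {k n : ℕ} {X : Matrix (Fin k) (Fin k) ℝ}
    {M : Matrix (Fin k) (Fin n) ℝ} (h : LinearIndependent ℝ (fun i => (X * M) i)) :
    X.det ≠ 0 := by
  intro h0
  obtain ⟨x, hx, hx0⟩ := Matrix.exists_vecMul_eq_zero_iff.2 h0
  refine hx ((rows_independent_iff _).1 h x ?_)
  rw [← Matrix.vecMul_vecMul, hx0, Matrix.zero_vecMul]

lemma rows_independent_mul {k n : ℕ} {X : Matrix (Fin k) (Fin k) ℝ} (hX : X.det ≠ 0)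
    {M : Matrix (Fin k) (Fin n) ℝ} (hM : LinearIndependent ℝ (fun i => M i)) :
    LinearIndependent ℝ (fun i => (X * M) i) := by
  rw [rows_independent_iff]
  intro x hx
  rw [← Matrix.vecMul_vecMul] at hx
  by_contra hne
  exact hX (Matrix.exists_vecMul_eq_zero_iff.1 ⟨x, hne, (rows_independent_iff _).1 hM _ hx⟩)

lemma rows_independent_of_mul_transpose_eq_one {k n : ℕ} {C : Matrix (Fin k) (Fin n) ℝ}
    (hC : C * C.transpose = 1) : LinearIndependent ℝ (fun i => C i) := by
  rw [rows_independent_iff]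
  intro x hx
  rw [← Matrix.vecMul_one x, ← hC, ← Matrix.vecMul_vecMul, hx, Matrix.zero_vecMul]

/-- Matrices with orthonormal rows whose maximal minors all have the same weak sign. -/
def orthoNonneg (k n : ℕ) : Set (Matrix (Fin k) (Fin n) ℝ) :=
  {C | C * C.transpose = 1 ∧ ∀ f g : Fin k → Fin n, StrictMono f → StrictMono g →
    0 ≤ (C.submatrix id f).det * (C.submatrix id g).det}

lemma isCompact_orthoNonneg (k n : ℕ) : IsCompact (orthoNonneg k n) := by
  have hbox : IsCompact (Set.univ.pi fun _ : Fin k => Set.univ.pi fun _ : Fin n =>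
      Set.Icc (-1 : ℝ) 1) :=
    isCompact_univ_pi fun _ => isCompact_univ_pi fun _ => isCompact_Icc
  have hclosed : IsClosed (orthoNonneg k n) := by
    rw [orthoNonneg, Set.ofPred_and]
    refine IsClosed.inter (isClosed_eq (continuous_id.matrix_mul continuous_id.matrix_transpose)
      continuous_const) ?_
    simp only [Set.ofPred_forall]
    refine isClosed_iInter fun f => isClosed_iInter fun g => isClosed_iInter fun _ =>
      isClosed_iInter fun _ => isClosed_le continuous_const ?_
    exact (continuous_id.matrix_submatrix id f).matrix_det.mul
      (continuous_id.matrix_submatrix id g).matrix_det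
  refine hbox.of_isClosed_subset hclosed fun (C : Matrix (Fin k) (Fin n) ℝ) hC i _ j _ => ?_
  have h1 := congrFun (congrFun hC.1 i) i
  rw [Matrix.mul_apply, Matrix.one_apply_eq] at h1
  have h2 : C i j * C i j ≤ 1 := by
    rw [← h1]
    exact Finset.single_le_sum (f := fun j => C i j * C.transpose j i)
      (fun j _ => mul_self_nonneg _) (Finset.mem_univ j)
  exact ⟨by nlinarith, by nlinarith⟩

lemma exists_mul_minorsNonneg {k n : ℕ} (hk : 1 ≤ k) {C : Matrix (Fin k) (Fin n) ℝ}
    (h : ∀ f g : Fin k → Fin n, StrictMono f → StrictMono g →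
      0 ≤ (C.submatrix id f).det * (C.submatrix id g).det) :
    ∃ S : Matrix (Fin k) (Fin k) ℝ, S.det ≠ 0 ∧ MinorsNonneg (S * C) := by
  have hmul : ∀ (S : Matrix (Fin k) (Fin k) ℝ) (f : Fin k → Fin n),
      ((S * C).submatrix id f).det = S.det * (C.submatrix id f).det := fun S f => by
    rw [← Matrix.det_mul]; rfl
  by_cases hpos : ∀ f : Fin k → Fin n, StrictMono f → 0 ≤ (C.submatrix id f).det
  · exact ⟨1, by simp, by rwa [Matrix.one_mul]⟩
  · push Not at hpos
    obtain ⟨f, hf, hneg⟩ := hpos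
    have hS : (Matrix.diagonal fun i : Fin k => if i = ⟨0, hk⟩ then (-1 : ℝ) else 1).det = -1 := by
      rw [Matrix.det_diagonal, Finset.prod_ite_eq' Finset.univ]
      simp
    refine ⟨Matrix.diagonal fun i : Fin k => if i = ⟨0, hk⟩ then (-1 : ℝ) else 1,
      by rw [hS]; norm_num, fun g hg => ?_⟩
    rw [hmul, hS]
    nlinarith [h f g hf hg]

/-- The projection from full-rank matrices to the Grassmannian. -/
def grProj (k n : ℕ) : FullRk k n → Gr k n := Quotient.mk (grSetoid k n)

lemma isQuotientMap_grProj (k n : ℕ) : Topology.IsQuotientMap (grProj k n) :=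
  isQuotientMap_quotient_mk'

theorem isClosed_amplituhedron {k n : ℕ} (hk : 1 ≤ k) (hkn : k + 2 ≤ n)
    (Z : Matrix (Fin n) (Fin (k + 2)) ℝ) (hZ : posMaxMinors Z) :
    IsClosed {P | ∃ (C : Matrix (Fin k) (Fin n) ℝ)
        (_ : LinearIndependent ℝ (fun i => C i)),
        (∀ (S : Finset (Fin n)) (h : S.card = k), 0 ≤ pluck C S h) ∧
        ∃ (E : Matrix (Fin k) (Fin (k + 2)) ℝ)
          (hE : LinearIndependent ℝ (fun i => E i)),
          grMk E hE = P ∧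
          Submodule.span ℝ (Set.range (fun i => E i)) =
            Submodule.span ℝ (Set.range (fun i => (C * Z) i))} := by
  refine (isQuotientMap_grProj k (k + 2)).isClosed_preimage.1 ?_
  have : CompactSpace (orthoNonneg k n) := isCompact_iff_compactSpace.1 (isCompact_orthoNonneg k n)
  have hT : IsClosed {p : FullRk k (k + 2) × orthoNonneg k n |
      p.1.1 * (p.2.1 * Z).transpose * ((p.2.1 * Z) * (p.2.1 * Z).transpose).adjugate * (p.2.1 * Z) =
        ((p.2.1 * Z) * (p.2.1 * Z).transpose).det • p.1.1} := by
    have h1 : Continuous fun p : FullRk k (k + 2) × orthoNonneg k n => p.1.1 :=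
      continuous_subtype_val.comp continuous_fst
    have h2 : Continuous fun p : FullRk k (k + 2) × orthoNonneg k n => p.2.1 * Z :=
      (continuous_subtype_val.comp continuous_snd).matrix_mul continuous_const
    have h3 := h2.matrix_mul h2.matrix_transpose
    exact isClosed_eq
      (((h1.matrix_mul h2.matrix_transpose).matrix_mul h3.matrix_adjugate).matrix_mul h2) (h3.matrix_det.smul h1)
  convert isClosedMap_fst_of_compactSpace _ hT
  ext E
  constructor
  · rintro ⟨C, hC, hpl, E', hE', hEE, hsp⟩
    have hEsp : Submodule.span ℝ (Set.range (fun i => E.1 i)) =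
      Submodule.span ℝ (Set.range (fun i => (C * Z) i)) := (Quotient.exact hEE).symm.trans hsp
    obtain ⟨G, hG, hGC⟩ := exists_orthonormalize hC
    have hGK : G * C ∈ orthoNonneg k n := by
      refine ⟨hGC, fun f g hf hg => ?_⟩
      have hmul : ∀ f : Fin k → Fin n,
          ((G * C).submatrix id f).det = G.det * (C.submatrix id f).det := fun f => by
        rw [← Matrix.det_mul]; rfl
      have hnn := (minorsNonneg_iff C).2 hpl
      rw [hmul, hmul, mul_mul_mul_comm]
      exact mul_nonneg (mul_self_nonneg _) (mul_nonneg (hnn f hf) (hnn g hg))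
    obtain ⟨X, hX⟩ := (span_rows_le_iff E.1 (G * C * Z)).1
      (by rw [Matrix.mul_assoc, span_rows_mul_eq hG, hEsp])
    refine ⟨(E, ⟨G * C, hGK⟩), ?_, rfl⟩
    show E.1 * (G * C * Z).transpose * ((G * C * Z) * (G * C * Z).transpose).adjugate *
      (G * C * Z) = ((G * C * Z) * (G * C * Z).transpose).det • E.1
    rw [hX, Matrix.mul_assoc X, Matrix.mul_assoc X, Matrix.mul_adjugate, Matrix.mul_smul,
      Matrix.mul_one, Matrix.smul_mul]
  · rintro ⟨⟨E', C⟩, h, rfl⟩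
    replace h : E'.1 * (C.1 * Z).transpose * ((C.1 * Z) * (C.1 * Z).transpose).adjugate *
      (C.1 * Z) = ((C.1 * Z) * (C.1 * Z).transpose).det • E'.1 := h
    obtain ⟨S, hS, hSC⟩ := exists_mul_minorsNonneg hk C.2.2
    have hrk := rows_independent_mul hS (rows_independent_of_mul_transpose_eq_one C.2.1)
    have hrkZ := hSC.mul_rows_independent hkn hrk hZ
    rw [Matrix.mul_assoc] at hrkZ
    have hsp := span_rows_mul_eq hS (C.1 * Z)
    have hM : LinearIndependent ℝ (fun i => (C.1 * Z) i) := by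
      have h1 : C.1 * Z = S⁻¹ * (S * (C.1 * Z)) := by
        rw [← Matrix.mul_assoc, Matrix.nonsing_inv_mul _ hS.isUnit, Matrix.one_mul]
      rw [h1]
      exact rows_independent_mul (Matrix.isUnit_nonsing_inv_det _ hS.isUnit).ne_zero hrkZ
    have hdet := mul_transpose_det_ne_zero hM
    obtain ⟨X, hX⟩ : ∃ X : Matrix (Fin k) (Fin k) ℝ, E'.1 = X * (C.1 * Z) := by
      refine ⟨((C.1 * Z) * (C.1 * Z).transpose).det⁻¹ • (E'.1 * (C.1 * Z).transpose *
        ((C.1 * Z) * (C.1 * Z).transpose).adjugate), ?_⟩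
      rw [Matrix.smul_mul, h, smul_smul, inv_mul_cancel₀ hdet, one_smul]
    have hXdet : X.det ≠ 0 := by
      have := E'.2
      rw [hX] at this
      exact det_ne_zero_of_rows_independent_mul this
    refine ⟨S * C.1, hrk, (minorsNonneg_iff _).1 hSC, E'.1, E'.2, rfl, ?_⟩
    rw [Matrix.mul_assoc, hsp, hX, span_rows_mul_eq hXdet]

lemma twistBil_mul_eq {k : ℕ} (Y : Matrix (Fin k) (Fin (k + 2)) ℝ) {u v : Fin (k + 2) → ℝ}
    (h : twistBil Y u v ≠ 0) (x y : Fin (k + 2) → ℝ) :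
    twistBil Y u v * twistBil Y x y =
      twistBil Y u x * twistBil Y v y - twistBil Y u y * twistBil Y v x := by
  have hex : ∀ z : Fin (k + 2) → ℝ, ∃ (p q : ℝ) (w : Fin (k + 2) → ℝ),
      z = w + p • u + q • v ∧ ∀ z', twistBil Y z' w = 0 := by
    intro z
    set M : Matrix (Fin (k + 2)) (Fin (k + 2)) ℝ :=
      Matrix.of (Fin.append (fun i => Y i) ![u, v]) with hM
    have hu : IsUnit M.det := IsUnit.mk0 _ h
    set c := Matrix.vecMul z M⁻¹ with hc
    have hz : z = Matrix.vecMul c M := by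
      rw [hc, Matrix.vecMul_vecMul, Matrix.nonsing_inv_mul _ hu, Matrix.vecMul_one]
    refine ⟨c (Fin.natAdd k 0), c (Fin.natAdd k 1), ∑ i : Fin k, c (Fin.castAdd 2 i) • Y i,
      ?_, fun z' => ?_⟩
    · rw [hz, Matrix.vecMul_eq_sum, Fin.sum_univ_add, Fin.sum_univ_two, add_assoc]
      have hrow : ∀ i, M (Fin.castAdd 2 i) = Y i := fun i => Fin.append_left _ _ i
      have h0 : M (Fin.natAdd k 0) = u := Fin.append_right _ _ 0
      have h1 : M (Fin.natAdd k 1) = v := Fin.append_right _ _ 1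
      simp only [hrow, h0, h1]
    · rw [map_sum]
      exact Finset.sum_eq_zero fun i _ => by rw [map_smul, twistBil_row_right, smul_zero]
  obtain ⟨p, q, w, rfl, hw⟩ := hex x
  obtain ⟨p', q', w', rfl, hw'⟩ := hex y
  have hwl : ∀ z', twistBil Y w z' = 0 := fun z' => by rw [twistBil_antisymm, hw, neg_zero]
  have hvu := twistBil_antisymm Y v u
  simp only [map_add, LinearMap.add_apply, map_smul, LinearMap.smul_apply, hw, hw', hwl,
    twistBil_self, hvu, smul_eq_mul]
  ring

lemma IsGeneric.flips_eq {k N : ℕ} (hk : 1 ≤ k) (hkn : k + 2 ≤ N + 1)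
    {Z : Matrix (Fin (N + 1)) (Fin (k + 2)) ℝ} (hZ : posMaxMinors Z)
    {C : Matrix (Fin k) (Fin (N + 1)) ℝ} (hC : IsGeneric Z C) :
    flips (fun i => twistBil (C * Z) (Z 0) (Z (Fin.ofNat (N + 1) (i + 1)))) (N - 1) = k := by
  set v : ℕ → ℝ := fun i => twistBil (C * Z) (Z 0) (Z (Fin.ofNat (N + 1) (i + 1))) with hv
  have hof : ∀ i : Fin N, Fin.ofNat (N + 1) (i + 1) = i.succ := fun i => by
    ext
    rw [Fin.val_ofNat, Fin.val_succ, Nat.mod_eq_of_lt (by omega)]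
  have hv0 : ∀ i < N, v i ≠ 0 := fun i hi => by
    have := hof ⟨i, hi⟩
    simp only at this
    rw [hv]
    simp only [this]
    exact hC.2 _ _ (Fin.succ_ne_zero _).symm
  refine le_antisymm ?_ ?_
  · by_contra hlt
    obtain ⟨g, hg, hgN, halt⟩ := exists_alternating (N := N) (m := k + 1) (by omega) hv0 (by omega)
    set l : Fin (k + 2) → ℝ := fun c =>
      -v 0 * twistBil (C * Z) (Z 0) (fun i => if c = i then 1 else 0) with hl
    have hl' : ∀ j, Matrix.vecMul l Z.transpose j = -v 0 * twistBil (C * Z) (Z 0) (Z j) := by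
      intro j
      rw [LinearMap.pi_apply_eq_sum_univ (twistBil (C * Z) (Z 0)) (Z j), Finset.mul_sum]
      show ∑ c, l c * Z.transpose c j = _
      refine Finset.sum_congr rfl fun c _ => ?_
      simp only [hl, Matrix.transpose_apply, smul_eq_mul]
      ring
    set g' : Fin (k + 2 + 1) → Fin (N + 1) :=
      Fin.cons 0 (fun t => Fin.succ ⟨g t, hgN t⟩) with hg'
    have hg'm : StrictMono g' := by
      refine Fin.strictMono_iff_lt_succ.2 fun i => ?_
      refine Fin.cases ?_ (fun i => ?_) i
      · exact Fin.succ_pos _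
      · rw [← Fin.succ_castSucc]
        simp only [hg', Fin.cons_succ, Fin.succ_lt_succ_iff, Fin.mk_lt_mk]
        exact hg (Fin.castSucc_lt_succ)
    have hvg : ∀ t, Matrix.vecMul l Z.transpose (g' (Fin.succ t)) = - (v 0 * v (g t)) := fun t => by
      rw [hl', hg', Fin.cons_succ, ← hof]
      simp [hv]
    have := hZ.transpose.eq_zero_of_alternating l hg'm (fun i => ?_) (Fin.succ 0)
    · rw [hvg] at this
      have h1 := halt 0
      simp at h1 this
      rcases this with h | h <;> rw [h] at h1 <;> simp at h1
    · refine Fin.cases ?_ (fun i => ?_) i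
      · rw [hl', hg', Fin.cons_zero, twistBil_self]; simp
      · rw [hvg, Fin.val_succ, pow_succ]
        have := halt i
        nlinarith
  · have hC' : MinorsPos (C.submatrix id Fin.succ : Matrix (Fin k) (Fin N) ℝ) := fun f hf =>
      hC.1 (Fin.succ ∘ f) ((Fin.strictMono_succ).comp hf)
    refine hC'.le_flips hk (by omega) hv0 fun r => ?_
    have h := twistBil_row_right (C * Z) (Z 0) r
    rw [mul_row_eq, map_sum, Fin.sum_univ_succ] at h
    simp only [map_smul, smul_eq_mul, twistBil_self, mul_zero, zero_add] at h
    rw [← h]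
    refine Finset.sum_congr rfl fun j _ => ?_
    simp only [hv, hof]
    rfl

lemma twistBil_mul_succ_pos {k N : ℕ} (hkn : k + 2 ≤ N + 1) {C : Matrix (Fin k) (Fin (N + 1)) ℝ}
    {Z : Matrix (Fin (N + 1)) (Fin (k + 2)) ℝ} (hC : MinorsPos C) (hZ : posMaxMinors Z)
    (j : Fin (N + 1)) :
    0 < (if j = Fin.last N then (-1 : ℝ) ^ (k + 1) else 1) *
      twistBil (C * Z) (Z j) (Z (finRotate (N + 1) j)) := by
  have hne : j ≠ finRotate (N + 1) j := fun h => by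
    have h1 := coe_finRotate j
    rw [← h] at h1
    split_ifs at h1 with h2
    · rw [h2, Fin.val_last] at h1; omega
    · omega
  by_cases hj : j = Fin.last N
  · subst hj
    have := twist_mul_pos hkn hC hZ _ _ hne (-1) (fun i h1 h2 => ?_)
    · rw [finRotate_last] at this ⊢
      rw [if_pos rfl, pow_succ, twistBil_apply]
      simp only [Fin.val_last, Fin.val_zero, Nat.cast_zero, zero_sub] at this
      have hN : (0 : ℝ) < N := by exact_mod_cast (by omega : 0 < N)
      refine (mul_pos_iff_of_pos_left hN).1 ?_
      linarith
    · rw [finRotate_last] at h2 ⊢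
      have h3 : (i : ℕ) < N := by
        have : (i : ℕ) ≠ N := fun h => h1 (Fin.ext h)
        omega
      have h4 : (0 : ℕ) < i := by
        have : (i : ℕ) ≠ 0 := fun h => h2 (Fin.ext h)
        omega
      have h3' : ((i : ℕ) : ℝ) < N := by exact_mod_cast h3
      have h4' : (0 : ℝ) < (i : ℕ) := by exact_mod_cast h4
      simp only [Fin.val_last, Fin.val_zero, Nat.cast_zero, zero_sub]
      nlinarith [mul_pos (sub_pos.2 h3') h4']
  · have hval := coe_finRotate_of_ne_last hj
    have := twist_mul_pos hkn hC hZ _ _ hne 1 (fun i h1 h2 => ?_)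
    · rw [hval] at this
      rw [if_neg hj, twistBil_apply]
      push_cast at this
      simpa using this
    · rw [hval]
      have h3 : (i : ℕ) ≠ j := fun h => h1 (Fin.ext h)
      have h4 : (i : ℕ) ≠ j + 1 := fun h => h2 (Fin.ext (by rw [hval, h]))
      rcases lt_or_gt_of_ne h3 with h | h
      · have : ((i : ℕ) : ℝ) < (j : ℕ) := by exact_mod_cast h
        push_cast
        rw [one_mul]
        exact mul_pos (by linarith) (by linarith)
      · have : (((j : ℕ) + 1 : ℕ) : ℝ) < (i : ℕ) := by exact_mod_cast (by omega)
        push_cast at this ⊢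
        rw [one_mul]
        exact mul_pos_of_neg_of_neg (by linarith) (by linarith)

lemma exists_perm_symm_lt_iff {n : ℕ} {κ : Fin n → ℝ} (hκ : Function.Injective κ) :
    ∃ w : Equiv.Perm (Fin n), ∀ i j, w.symm i < w.symm j ↔ κ i < κ j := by
  have h : StrictMono (κ ∘ Tuple.sort κ) :=
    (Tuple.monotone_sort κ).strictMono_of_injective (hκ.comp (Tuple.sort κ).injective)
  refine ⟨Tuple.sort κ, fun i j => ?_⟩
  rw [← h.lt_iff_lt]
  simp

lemma val_finRotate_symm {N : ℕ} (j : Fin (N + 1)) :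
    ((finRotate (N + 1)).symm j : ℕ) = if (j : ℕ) = 0 then N else (j : ℕ) - 1 := by
  have h := coe_finRotate ((finRotate (N + 1)).symm j)
  rw [Equiv.apply_symm_apply] at h
  split_ifs at h with h1
  · rw [h1, h]; simp
  · rw [if_neg (by omega)]; omega

lemma val_finRotate_pow {N : ℕ} (m : ℕ) (p : Fin (N + 1)) :
    (((finRotate (N + 1)) ^ m) p : ℕ) = (p + m) % (N + 1) := by
  induction m with
  | zero => simp [Nat.mod_eq_of_lt p.2]
  | succ m ih =>
    rw [pow_succ', Equiv.Perm.mul_apply, finRotate_apply, Fin.val_add, ih]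
    rcases N with _ | N
    · simp [Nat.mod_one]
    · rw [Fin.val_one, ← add_assoc, Nat.mod_add_mod]

lemma rotTo_symm_lt_iff {N : ℕ} (w : Equiv.Perm (Fin (N + 1))) (a i j : Fin (N + 1)) :
    (rotTo w a).symm i < (rotTo w a).symm j ↔
      ((w.symm a < w.symm i ↔ w.symm a < w.symm j) ∧ w.symm i < w.symm j) ∨
        (w.symm a < w.symm i ∧ ¬ w.symm a < w.symm j) := by
  have key : ∀ i, (((rotTo w a).symm i : ℕ) + ((w.symm a : ℕ) + 1)) % (N + 1) = w.symm i := by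
    intro i
    rw [← val_finRotate_pow]
    congr 1
    rw [Equiv.eq_symm_apply]
    exact (rotTo w a).apply_symm_apply i
  have key' : ∀ i, ((rotTo w a).symm i : ℕ) = if (w.symm a : ℕ) < w.symm i then
      (w.symm i : ℕ) - w.symm a - 1 else w.symm i + N - w.symm a := by
    intro i
    have h := key i
    have h1 := ((rotTo w a).symm i).2
    have h2 := (w.symm i).2
    have h3 := (w.symm a).2
    by_cases hlt : ((rotTo w a).symm i : ℕ) + ((w.symm a : ℕ) + 1) < N + 1
    · rw [Nat.mod_eq_of_lt hlt] at h
      rw [if_pos (by omega)]; omega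
    · rw [Nat.mod_eq_sub_mod (by omega), Nat.mod_eq_of_lt (by omega)] at h
      rw [if_neg (by omega)]; omega
  simp only [Fin.lt_def]
  rw [key' i, key' j]
  have h1 := (w.symm i).2
  have h2 := (w.symm j).2
  have h3 := (w.symm a).2
  split_ifs <;> omega

lemma mem_cdes_iff {N : ℕ} (w : Equiv.Perm (Fin (N + 1))) (j : Fin (N + 1)) :
    j ∈ cdes w ↔ w.symm j < w.symm ((finRotate (N + 1)).symm j) := by
  have hval := val_finRotate_symm j
  simp only [cdes, Finset.mem_filter, Finset.mem_univ, true_and]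
  by_cases hj : (j : ℕ) = 0
  · rw [if_pos hj] at hval
    have h : (finRotate (N + 1)).symm j = ⟨N + 1 - 1, by omega⟩ := Fin.ext hval
    simp [hj, h]
  · rw [if_neg hj] at hval
    have h : (finRotate (N + 1)).symm j = ⟨(j : ℕ) - 1, by omega⟩ := Fin.ext hval
    simp [hj, h]

lemma mem_Iset_iff {N : ℕ} {w : Equiv.Perm (Fin (N + 1))} {c : Fin (N + 1) → ℝ}
    (hw : ∀ i j, w.symm i < w.symm j ↔ c (finRotate (N + 1) i) < c (finRotate (N + 1) j))
    (hmax : ∀ j, c j ≤ c 0) (q j : Fin (N + 1)) :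
    j ∈ Iset w q ↔ ((c q < c (finRotate (N + 1) j) ↔ c q < c j) ∧ c (finRotate (N + 1) j) < c j) ∨
      (c q < c (finRotate (N + 1) j) ∧ ¬ c q < c j) := by
  unfold Iset
  split_ifs with h
  · have hq : q = 0 := Fin.ext h
    subst hq
    rw [mem_cdes_iff, hw, Equiv.apply_symm_apply]
    have h1 := (hmax j).not_gt
    have h2 := (hmax (finRotate (N + 1) j)).not_gt
    tauto
  · have hq : (⟨(q : ℕ) - 1, Nat.lt_of_le_of_lt (Nat.sub_le _ _) q.isLt⟩ : Fin (N + 1)) =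
        (finRotate (N + 1)).symm q := by
      refine Fin.ext ?_
      rw [val_finRotate_symm, if_neg h]
    rw [mem_cdes_iff, hq, rotTo_symm_lt_iff]
    simp only [hw, Equiv.apply_symm_apply]

lemma exists_slope_order {N : ℕ} {d : Fin (N + 1) → Fin (N + 1) → ℝ}
    (hanti : ∀ i j, d i j = - d j i) (hne : ∀ i j, i ≠ j → d i j ≠ 0) (e : Fin (N + 1))
    (he : 0 < d 0 e) (hpl : ∀ i j, d 0 e * d i j = d 0 i * d e j - d 0 j * d e i) :
    ∃ τ c : Fin (N + 1) → ℝ, (∀ j, τ j ≠ 0) ∧ (∀ j, j ≠ 0 → τ j = d 0 j) ∧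
      Function.Injective c ∧ (∀ j, c j ≤ c 0) ∧
      ∀ i j, i ≠ j → (0 < d i j * (τ i * τ j) ↔ c i < c j) := by
  set τ : Fin (N + 1) → ℝ := fun j => if j = 0 then -1 else d 0 j with hτ
  set m : Fin (N + 1) → ℝ := fun j => d e j / d 0 j with hm
  set c : Fin (N + 1) → ℝ := fun j => if j = 0 then ∑ i, |m i| + 1 else m j with hc
  have hτ0 : ∀ j, τ j ≠ 0 := fun j => by
    simp only [hτ]
    split_ifs with h
    · norm_num
    · exact hne _ _ (Ne.symm h)
  have hlt : ∀ j, j ≠ 0 → c j < c 0 := fun j hj => by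
    have h1 : |m j| ≤ ∑ i, |m i| :=
      Finset.single_le_sum (f := fun i => |m i|) (fun i _ => abs_nonneg _) (Finset.mem_univ j)
    have h2 := le_abs_self (m j)
    simp only [hc, if_neg hj, if_true]
    linarith
  have hsgn : ∀ i j, i ≠ j → (0 < d i j * (τ i * τ j) ↔ c i < c j) := by
    intro i j hij
    by_cases hi : i = 0
    · subst hi
      refine iff_of_false ?_ (hlt j hij.symm).not_gt
      have h : d 0 j * (τ 0 * τ j) = - (d 0 j * d 0 j) := by
        simp only [hτ, if_true, if_neg hij.symm]; ring
      rw [h]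
      have := mul_self_nonneg (d 0 j)
      linarith
    by_cases hj : j = 0
    · subst hj
      refine iff_of_true ?_ (hlt i hi)
      have h : d i 0 * (τ i * τ 0) = d i 0 * d i 0 := by
        simp only [hτ, if_true, if_neg hi, hanti 0 i]; ring
      rw [h]
      exact mul_self_pos.2 (hne _ _ hi)
    · have hmi : m i * τ i = d e i := by
        simp only [hm, hτ, if_neg hi]; exact div_mul_cancel₀ _ (hne _ _ (Ne.symm hi))
      have hmj : m j * τ j = d e j := by
        simp only [hm, hτ, if_neg hj]; exact div_mul_cancel₀ _ (hne _ _ (Ne.symm hj))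
      have hτi : τ i = d 0 i := if_neg hi
      have hτj : τ j = d 0 j := if_neg hj
      have h : d 0 e * (d i j * (τ i * τ j)) = (τ i * τ j) ^ 2 * (c j - c i) := by
        have hci : c i = m i := if_neg hi
        have hcj : c j = m j := if_neg hj
        rw [← mul_assoc, hpl, ← hτi, ← hτj, ← hmi, ← hmj, hci, hcj]
        ring
      have hpos : 0 < (τ i * τ j) ^ 2 := by
        have := hτ0 i; have := hτ0 j; positivity
      rw [← mul_pos_iff_of_pos_left he, h, mul_pos_iff_of_pos_left hpos, sub_pos]
  refine ⟨τ, c, hτ0, fun j hj => if_neg hj, fun i j hij => ?_, fun j => ?_, hsgn⟩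
  · by_contra hne'
    have h1 := (hsgn i j hne').not.2 (by rw [hij]; exact lt_irrefl _)
    have h2 := (hsgn j i (Ne.symm hne')).not.2 (by rw [hij]; exact lt_irrefl _)
    rw [hanti j i] at h2
    have h3 : d i j * (τ i * τ j) ≠ 0 :=
      mul_ne_zero (hne _ _ hne') (mul_ne_zero (hτ0 i) (hτ0 j))
    apply h3
    linarith
  · by_cases hj : j = 0
    · rw [hj]
    · exact (hlt j hj).le

lemma mul_mul_neg_iff {x y z : ℝ} (hx : x ≠ 0) (hy : y ≠ 0) (hz : z ≠ 0) :
    x * y * z < 0 ↔ ¬ ((0 < x ↔ 0 < y) ↔ 0 < z) := by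
  rcases hx.lt_or_gt with h1 | h1 <;> rcases hy.lt_or_gt with h2 | h2 <;>
    rcases hz.lt_or_gt with h3 | h3 <;>
    simp [mul_neg_iff, mul_pos_iff, h1, h2, h3, h1.not_gt, h2.not_gt, h3.not_gt]

lemma vseq_eq {k n : ℕ} (Z : Matrix (Fin n) (Fin (k + 2)) ℝ) (Y : Matrix (Fin k) (Fin (k + 2)) ℝ)
    (a j : Fin n) :
    vseq Z Y a j = (if j < a then (-1 : ℝ) ^ (k + 1) else 1) * twistBil Y (Z a) (Z j) := by
  unfold vseq
  split_ifs
  · rw [← twistBil_apply, map_smul, smul_eq_mul]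
  · rw [one_mul, twistBil_apply]

lemma vseq_mul_vseq {k N : ℕ} (Z : Matrix (Fin (N + 1)) (Fin (k + 2)) ℝ)
    (Y : Matrix (Fin k) (Fin (k + 2)) ℝ) {a j : Fin (N + 1)} (hr : finRotate (N + 1) j ≠ a)
    (hj : j ≠ a) :
    vseq Z Y a j * vseq Z Y a (finRotate (N + 1) j) =
      (if j = Fin.last N then (-1 : ℝ) ^ (k + 1) else 1) *
        (twistBil Y (Z a) (Z j) * twistBil Y (Z a) (Z (finRotate (N + 1) j))) := by
  have hval : (finRotate (N + 1) j : ℕ) = if j = Fin.last N then 0 else (j : ℕ) + 1 :=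
    coe_finRotate j
  have hr' : (finRotate (N + 1) j : ℕ) ≠ a := fun h => hr (Fin.ext h)
  have hj' : (j : ℕ) ≠ a := fun h => hj (Fin.ext h)
  rw [vseq_eq, vseq_eq]
  by_cases hl : j = Fin.last N
  · rw [if_pos hl] at hval
    have hjN : (j : ℕ) = N := by rw [hl, Fin.val_last]
    have h1 : ¬ j < a := by rw [Fin.lt_def]; omega
    have h2 : finRotate (N + 1) j < a := by rw [Fin.lt_def]; omega
    rw [if_pos hl, if_neg h1, if_pos h2]
    ring
  · rw [if_neg hl] at hval
    have h1 : finRotate (N + 1) j < a ↔ j < a := by rw [Fin.lt_def, Fin.lt_def]; omega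
    have hs : ((-1 : ℝ) ^ (k + 1)) * (-1) ^ (k + 1) = 1 := by rw [← mul_pow]; simp
    simp only [h1, if_neg hl]
    split_ifs
    · linear_combination (twistBil Y (Z a) (Z j) *
        twistBil Y (Z a) (Z (finRotate (N + 1) j))) * hs
    · ring

theorem IsGeneric.exists_perm {k N : ℕ} (hk : 1 ≤ k) (hkn : k + 2 ≤ N + 1)
    {Z : Matrix (Fin (N + 1)) (Fin (k + 2)) ℝ} (hZ : posMaxMinors Z)
    {C : Matrix (Fin k) (Fin (N + 1)) ℝ} (hC : IsGeneric Z C) :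
    ∃ w : Equiv.Perm (Fin (N + 1)), w (Fin.last N) = Fin.last N ∧ (cdes w).card = k + 1 ∧
      ∀ a j, vseq Z (C * Z) a j * vseq Z (C * Z) a (finRotate (N + 1) j) < 0 ↔
        (j ∈ Iset w a ∧ j ≠ a) := by
  set r := finRotate (N + 1) with hr
  set d : Fin (N + 1) → Fin (N + 1) → ℝ := fun i j => twistBil (C * Z) (Z i) (Z j) with hd
  have hne : ∀ i j, i ≠ j → d i j ≠ 0 := hC.2
  have hsucc : ∀ j, 0 < (if j = Fin.last N then (-1 : ℝ) ^ (k + 1) else 1) * d j (r j) :=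
    twistBil_mul_succ_pos hkn hC.1 hZ
  have h0l : (0 : Fin (N + 1)) ≠ Fin.last N := fun h => by
    have := congrArg Fin.val h
    simp at this; omega
  have hrne : ∀ j, j ≠ r j := fun j h => by
    have h1 := hsucc j
    rw [← h] at h1
    simp [hd, twistBil_self] at h1
  have he : 0 < d 0 (r 0) := by
    have := hsucc 0
    rwa [if_neg h0l, one_mul] at this
  obtain ⟨τ, c, hτ, hτ0, hinj, hmax, hsgn⟩ := exists_slope_order (d := d)
    (fun i j => twistBil_antisymm _ _ _) hne (r 0) he (fun i j => twistBil_mul_eq _ he.ne' _ _)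
  obtain ⟨w, hw⟩ := exists_perm_symm_lt_iff (κ := c ∘ r) (hinj.comp r.injective)
  have hmem := mem_Iset_iff hw hmax
  refine ⟨w, ?_, ?_, fun a j => ?_⟩
  · have h1 : ¬ w.symm (Fin.last N) < w.symm (w (Fin.last N)) := by
      rw [hw, Function.comp_apply, Function.comp_apply, hr, finRotate_last]
      exact (hmax _).not_gt
    rw [Equiv.symm_apply_apply, not_lt, Fin.last_le_iff, Equiv.symm_apply_eq] at h1
    exact h1.symm
  · have hcd : ∀ j, j ∈ cdes w ↔ c (r j) < c j := fun j => by
      rw [mem_cdes_iff, hw, Function.comp_apply, Function.comp_apply, Equiv.apply_symm_apply]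
    set f : ℕ → Fin (N + 1) := fun i => Fin.ofNat (N + 1) (i + 1) with hf
    have hfv : ∀ i < N, (f i : ℕ) = i + 1 := fun i hi => by
      rw [hf, Fin.val_ofNat, Nat.mod_eq_of_lt (by omega)]
    have hfr : ∀ i < N - 1, r (f i) = f (i + 1) := fun i hi => by
      have hl : f i ≠ Fin.last N := fun h => by
        have := congrArg Fin.val h
        rw [hfv i (by omega), Fin.val_last] at this; omega
      refine Fin.ext ?_
      rw [hr, coe_finRotate_of_ne_last hl, hfv i (by omega), hfv (i + 1) (by omega)]
    have hfm : ∀ i < N - 1, f i ∈ cdes w ↔ d 0 (f i) * d 0 (f (i + 1)) < 0 := fun i hi => by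
      have hl : f i ≠ Fin.last N := fun h => by
        have := congrArg Fin.val h
        rw [hfv i (by omega), Fin.val_last] at this; omega
      have h1 : f i ≠ 0 := fun h => by
        have := congrArg Fin.val h
        rw [hfv i (by omega), Fin.val_zero] at this; omega
      have h2 : f (i + 1) ≠ 0 := fun h => by
        have := congrArg Fin.val h
        rw [hfv (i + 1) (by omega), Fin.val_zero] at this; omega
      have hs := hsucc (f i)
      rw [if_neg hl, one_mul] at hs
      have h3 := hsgn _ _ (hrne (f i))
      rw [mul_pos_iff_of_pos_left hs, hfr i hi, hτ0 _ h1, hτ0 _ h2] at h3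
      have hcne : c (f i) ≠ c (f (i + 1)) := fun h => hrne (f i) (by rw [hfr i hi]; exact hinj h)
      have hpne : d 0 (f i) * d 0 (f (i + 1)) ≠ 0 :=
        mul_ne_zero (hne _ _ h1.symm) (hne _ _ h2.symm)
      rw [hcd, hfr i hi]
      grind
    have himg : cdes w = insert 0 (((Finset.range (N - 1)).filter
        fun i => d 0 (f i) * d 0 (f (i + 1)) < 0).image f) := by
      ext j
      rw [Finset.mem_insert, Finset.mem_image]
      constructor
      · intro hj
        by_cases hj0 : j = 0
        · exact Or.inl hj0
        · right
          have hjv : (j : ℕ) ≠ 0 := fun h => hj0 (Fin.ext h)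
          have hjl : (j : ℕ) ≠ N := fun h => by
            have h1 : j = Fin.last N := Fin.ext h
            rw [hcd, h1, hr, finRotate_last] at hj
            exact (hmax _).not_gt hj
          have hfj : f ((j : ℕ) - 1) = j := by
            refine Fin.ext ?_
            rw [hfv _ (by omega)]; omega
          refine ⟨(j : ℕ) - 1, ?_, hfj⟩
          rw [Finset.mem_filter, Finset.mem_range]
          refine ⟨by omega, (hfm _ (by omega)).1 (by rwa [hfj])⟩
      · rintro (rfl | ⟨i, hi, rfl⟩)
        · rw [hcd]
          exact lt_of_le_of_ne (hmax _) fun h => hrne 0 (hinj h).symm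
        · rw [Finset.mem_filter, Finset.mem_range] at hi
          exact (hfm i hi.1).2 hi.2
    rw [himg, Finset.card_insert_of_notMem, Finset.card_image_of_injOn]
    · exact congrArg (· + 1) (hC.flips_eq hk hkn hZ)
    · intro i hi i' hi' h
      have h1 := congrArg Fin.val h
      simp only [Finset.coe_filter, Finset.mem_range, Set.mem_ofPred_eq] at hi hi'
      rw [hfv i (by omega), hfv i' (by omega)] at h1
      omega
    · rw [Finset.mem_image]
      rintro ⟨i, hi, h⟩
      rw [Finset.mem_filter, Finset.mem_range] at hi
      have := congrArg Fin.val h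
      rw [hfv i (by omega), Fin.val_zero] at this; omega
  · by_cases hja : j = a
    · subst hja
      simp [vseq_eq, twistBil_self]
    by_cases hra : r j = a
    · have h0 : vseq Z (C * Z) a (r j) = 0 := by rw [hra, vseq_eq, twistBil_self, mul_zero]
      rw [h0, mul_zero, hmem, ← hr, hra]
      have h1 := lt_irrefl (c a)
      have h2 := lt_asymm (a := c a) (b := c j)
      have h3 := lt_irrefl (0 : ℝ)
      tauto
    rw [vseq_mul_vseq Z _ hra hja, hmem, ← hr]
    have h1 := hsgn a j (Ne.symm hja)
    have h2 := hsgn a (r j) (Ne.symm hra)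
    have h3 := hsgn j (r j) (hrne j)
    have n1 := mul_ne_zero (hne a j (Ne.symm hja)) (mul_ne_zero (hτ a) (hτ j))
    have n2 := mul_ne_zero (hne a (r j) (Ne.symm hra)) (mul_ne_zero (hτ a) (hτ (r j)))
    have n3 := mul_ne_zero (hne j (r j) (hrne j)) (mul_ne_zero (hτ j) (hτ (r j)))
    have hneg := mul_mul_neg_iff n1 n2 n3
    rw [h1, h2, h3] at hneg
    have heq : d a j * (τ a * τ j) * (d a (r j) * (τ a * τ (r j))) *
        (d j (r j) * (τ j * τ (r j))) < 0 ↔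
        (if j = Fin.last N then (-1 : ℝ) ^ (k + 1) else 1) * (d a j * d a (r j)) < 0 := by
      have hs := hsucc j
      set ε : ℝ := if j = Fin.last N then (-1 : ℝ) ^ (k + 1) else 1 with hε
      have hεε : ε * ε = 1 := by
        simp only [hε]
        split_ifs
        · rw [← mul_pow]; simp
        · norm_num
      have hsq : 0 < (τ a * τ j * τ (r j)) ^ 2 := by
        have := hτ a; have := hτ j; have := hτ (r j); positivity
      rw [← mul_lt_mul_iff_left₀ (mul_pos hs hsq) (b := _ * (d a j * d a (r j))), zero_mul]
      have : ε * (d a j * d a (r j)) * (ε * d j (r j) * (τ a * τ j * τ (r j)) ^ 2) =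
        ε * ε * (d a j * (τ a * τ j) * (d a (r j) * (τ a * τ (r j))) *
        (d j (r j) * (τ j * τ (r j)))) := by ring
      rw [this, hεε, one_mul]
    rw [← heq, hneg]
    have hcne : c j ≠ c (r j) := fun h => hrne j (hinj h)
    grind

/-- The `m = 2` amplituhedron is the union of the closed `w`-chambers over
`w ∈ D_{k+1,n}`: the chamber of `w` consists of the points all of whose
sign-flip sequences flip exactly in the positions `I_a(w) \ {a}`. -/
theorem stmt19 (k n : ℕ) (hk : 1 ≤ k) (hkn : k ≤ n - 2)
    (Z : Matrix (Fin n) (Fin (k + 2)) ℝ) (hZ : posMaxMinors Z)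
    (A : Set (Gr k (k + 2)))
    (hA : A = {P | ∃ (C : Matrix (Fin k) (Fin n) ℝ)
        (hC : LinearIndependent ℝ (fun i => C i)),
        (∀ (S : Finset (Fin n)) (h : S.card = k), 0 ≤ pluck C S h) ∧
        ∃ (E : Matrix (Fin k) (Fin (k + 2)) ℝ)
          (hE : LinearIndependent ℝ (fun i => E i)),
          grMk E hE = P ∧
          Submodule.span ℝ (Set.range (fun i => E i)) =
            Submodule.span ℝ (Set.range (fun i => (C * Z) i))}) :
    A = ⋃ w ∈ {w : Equiv.Perm (Fin n) |
        w ⟨n - 1, by omega⟩ = ⟨n - 1, by omega⟩ ∧ (cdes w).card = k + 1},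
      closure {P | P ∈ A ∧
        ∃ (Y : Matrix (Fin k) (Fin (k + 2)) ℝ)
          (hY : LinearIndependent ℝ (fun i => Y i)),
          grMk Y hY = P ∧
          ∀ a j : Fin n,
            (vseq Z Y a j * vseq Z Y a (finRotate n j) < 0) ↔
              (j ∈ Iset w a ∧ j ≠ a)} := by
  obtain ⟨N, rfl⟩ : ∃ N, n = N + 1 := ⟨n - 1, by omega⟩
  have hkN : k + 2 ≤ N + 1 := by omega
  have hclosed : IsClosed A := hA ▸ isClosed_amplituhedron hk hkN Z hZ
  refine Set.Subset.antisymm (fun P hP => ?_)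
    (Set.iUnion₂_subset fun w _ => closure_minimal (fun P h => h.1) hclosed)
  rw [← Set.Finite.closure_biUnion (Set.toFinite _)]
  rw [hA] at hP
  obtain ⟨C, hCrk, hpl, E, hE, rfl, hsp⟩ := hP
  have hnn : MinorsNonneg C := (minorsNonneg_iff C).2 hpl
  have hgen : ∀ {D : Matrix (Fin k) (Fin (N + 1)) ℝ}, IsGeneric Z D →
      LinearIndependent ℝ (fun i => D i) ∧ LinearIndependent ℝ (fun i => (D * Z) i) := fun hD =>
    have hrk := hD.1.rows_independent (by omega)
    ⟨hrk, hD.1.nonneg.mul_rows_independent hkN hrk hZ⟩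
  let Φ : {D : Matrix (Fin k) (Fin (N + 1)) ℝ // LinearIndependent ℝ (fun i => (D * Z) i)} →
      Gr k (k + 2) := fun D => grMk (D.1 * Z) D.2
  have hΦ : Continuous Φ := by
    refine (isQuotientMap_grProj k (k + 2)).continuous.comp (Continuous.subtype_mk ?_ _)
    exact continuous_subtype_val.matrix_mul continuous_const
  have hCZ := hnn.mul_rows_independent hkN hCrk hZ
  have hEC : grMk E hE = Φ ⟨C, hCZ⟩ := Quotient.sound hsp
  rw [hEC]
  refine map_mem_closure hΦ (s := {D | IsGeneric Z D.1}) ?_ fun D hD => ?_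
  · rw [closure_subtype]
    refine closure_mono ?_ (hnn.mem_closure_generic hkN hZ hCrk)
    exact fun D hD => ⟨⟨D, (hgen hD).2⟩, hD, rfl⟩
  · obtain ⟨w, hw, hcard, hflip⟩ := IsGeneric.exists_perm hk hkN hZ hD
    refine Set.mem_iUnion₂.2 ⟨w, ⟨hw, hcard⟩, ?_, D.1 * Z, D.2, rfl, hflip⟩
    rw [hA]
    exact ⟨D.1, (hgen hD).1, (minorsNonneg_iff _).1 hD.1.nonneg, D.1 * Z, D.2, rfl, rfl⟩
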